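/- arXiv:2511.07864 — 4 statements merged into one kernel-verified Lean document; each statement's English description precedes it below -/
import Mathlib

section
/- Let f : K → ℝ be a discrete Morse–Bott function on a CW complex K, C ∈ 𝒞_f a collection, and σ ∈ C an upward noncritical cell. Then every cell ν ∈ C with ν ≺ σ is upward noncritical. -/
/-!
Set-based CW complexes: a CW complex is identified with the family of its cells.
Each `n`-cell `τ` has a characteristic map `charMap τ : D^n → X` (from the closed
unit disk of `EuclideanSpace ℝ (Fin n)`), the open cells partition `X`, the closure
of each cell is the image of the closed disk, the boundary sphere is mapped into
finitely many cells of strictly lower dimension (closure finiteness), and `X`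
carries the weak topology determined by the closed cells.
-/

open Metric Set

structure CWComplexCells (X : Type) [TopologicalSpace X] [T2Space X] where
  /-- The (index type of the) cells of the complex. -/
  Cell : Type
  /-- The dimension of each cell. -/
  dim : Cell → ℕ
  /-- The characteristic map of each cell. -/
  charMap : (τ : Cell) → EuclideanSpace ℝ (Fin (dim τ)) → X
  charMap_continuousOn : ∀ τ, ContinuousOn (charMap τ) (closedBall 0 1)
  charMap_injOn : ∀ τ, InjOn (charMap τ) (ball 0 1)
  /-- Distinct (open) cells are disjoint. -/
  cells_disjoint : ∀ σ τ : Cell, σ ≠ τ →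
    Disjoint (charMap σ '' ball 0 1) (charMap τ '' ball 0 1)
  /-- The open cells cover the space. -/
  cells_cover : (⋃ τ : Cell, charMap τ '' ball 0 1) = univ
  /-- The closure of an open cell is the image of the closed disk. -/
  closure_cell : ∀ τ, closure (charMap τ '' ball 0 1) = charMap τ '' closedBall 0 1
  /-- Closure finiteness: the boundary sphere of each cell is mapped into a finite
  union of cells of strictly smaller dimension. -/
  sphere_subset : ∀ τ, ∃ I : Set Cell, I.Finite ∧ (∀ σ ∈ I, dim σ < dim τ) ∧
    charMap τ '' sphere 0 1 ⊆ ⋃ σ ∈ I, charMap σ '' ball 0 1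
  /-- Weak topology: a set is closed iff its intersection with each closed cell is closed. -/
  isClosed_iff : ∀ A : Set X, IsClosed A ↔ ∀ τ, IsClosed (A ∩ charMap τ '' closedBall 0 1)

namespace CWComplexCells

variable {X : Type} [TopologicalSpace X] [T2Space X] (K : CWComplexCells X)

/-- The (open) cell of `τ`, as a subset of the space. -/
def cellSet (τ : K.Cell) : Set X := K.charMap τ '' ball 0 1

/-- `ν` is a face of `τ` (written `ν < τ`): `ν ⊆ cl(τ) \ τ`. -/
def Face (ν τ : K.Cell) : Prop :=
  K.cellSet ν ⊆ closure (K.cellSet τ) \ K.cellSet τ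

/-- `ν` is a facet of `τ` (written `ν ≺ τ`): a face of codimension one. -/
def Facet (ν τ : K.Cell) : Prop := K.Face ν τ ∧ K.dim ν + 1 = K.dim τ

/-- The preimage of the cell `σ` under the characteristic map of `τ`,
inside the closed disk. -/
def preim (σ τ : K.Cell) : Set (EuclideanSpace ℝ (Fin (K.dim τ))) :=
  closedBall 0 1 ∩ K.charMap τ ⁻¹' K.cellSet σ

/-- `σ` is a regular face of `τ`: `σ < τ`, the restriction
`charMap τ : charMap τ ⁻¹(σ) → σ` is a homeomorphism, and the closure of
`charMap τ ⁻¹(σ)` is a closed `(dim σ)`-ball. -/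
def RegularFace (σ τ : K.Cell) : Prop :=
  K.Face σ τ ∧
  (∃ e : K.preim σ τ ≃ₜ K.cellSet σ,
    ∀ x : K.preim σ τ, (e x : X) = K.charMap τ (x : EuclideanSpace ℝ (Fin (K.dim τ)))) ∧
  Nonempty ((closure (K.preim σ τ)) ≃ₜ
    (closedBall (0 : EuclideanSpace ℝ (Fin (K.dim σ))) 1))

/-- `σ` is an irregular face of `τ`. -/
def IrregularFace (σ τ : K.Cell) : Prop := K.Face σ τ ∧ ¬ K.RegularFace σ τ

/-- `σ` is a regular facet of `τ`. -/
def RegularFacet (σ τ : K.Cell) : Prop := K.RegularFace σ τ ∧ K.dim σ + 1 = K.dim τ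

/-- `σ` is an irregular facet of `τ`. -/
def IrregularFacet (σ τ : K.Cell) : Prop := K.Facet σ τ ∧ ¬ K.RegularFace σ τ

/-- The set of upper noncritical neighbours of `σ`:
`(k+1)`-cells `τ` with `σ ≺ τ` and `f σ ≥ f τ`. -/
def Uset (f : K.Cell → ℝ) (σ : K.Cell) : Set K.Cell :=
  {τ | K.Facet σ τ ∧ f σ ≥ f τ}

/-- The set of lower noncritical neighbours of `σ`:
`(k-1)`-cells `ν` with `ν ≺ σ` and `f ν ≥ f σ`. -/
def Dset (f : K.Cell → ℝ) (σ : K.Cell) : Set K.Cell :=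
  {ν | K.Facet ν σ ∧ f ν ≥ f σ}

/-- `U(σ)`. -/
noncomputable def U (f : K.Cell → ℝ) (σ : K.Cell) : ℕ∞ := (K.Uset f σ).encard

/-- `D(σ)`. -/
noncomputable def D (f : K.Cell → ℝ) (σ : K.Cell) : ℕ∞ := (K.Dset f σ).encard

/-- `f` is a discrete Morse function. -/
def DiscreteMorse (f : K.Cell → ℝ) : Prop :=
  ∀ σ : K.Cell,
    (∀ τ, K.IrregularFacet σ τ → f σ < f τ) ∧
    K.U f σ ≤ 1 ∧
    (∀ ν, K.IrregularFacet ν σ → f ν < f σ) ∧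
    K.D f σ ≤ 1

/-- Two cells are adjacent if one is a facet of the other. -/
def Adjacent (σ τ : K.Cell) : Prop := K.Facet σ τ ∨ K.Facet τ σ

/-- There is an `r`-path from `σ` to `τ`: a sequence of cells on the level set
`f⁻¹(r)` in which consecutive cells are facets of one another. -/
def RPath (f : K.Cell → ℝ) (r : ℝ) (σ τ : K.Cell) : Prop :=
  f σ = r ∧ Relation.ReflTransGen (fun a b => K.Adjacent a b ∧ f b = r) σ τ

/-- A family of cells contained in one level set of `f` whose members are
pairwise joined by `c`-paths. -/
def IsPreCollection (f : K.Cell → ℝ) (C : Set K.Cell) : Prop :=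
  ∃ c : ℝ, (∀ σ ∈ C, f σ = c) ∧ ∀ σ ∈ C, ∀ τ ∈ C, K.RPath f c σ τ

/-- A collection for `f`: a maximal family of cells contained in one level set
of `f` whose members are pairwise joined by `c`-paths. -/
def IsCollection (f : K.Cell → ℝ) (C : Set K.Cell) : Prop :=
  K.IsPreCollection f C ∧ ∀ C', C ⊆ C' → K.IsPreCollection f C' → C' = C

/-- The set counted by `U^C(σ)`. -/
def UCset (f : K.Cell → ℝ) (C : Set K.Cell) (σ : K.Cell) : Set K.Cell :=
  {τ | τ ∉ C ∧ K.Facet σ τ ∧ f σ ≥ f τ}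

/-- The set counted by `D^C(σ)`. -/
def DCset (f : K.Cell → ℝ) (C : Set K.Cell) (σ : K.Cell) : Set K.Cell :=
  {ν | ν ∉ C ∧ K.Facet ν σ ∧ f ν ≥ f σ}

/-- `U^C(σ)`. -/
noncomputable def UC (f : K.Cell → ℝ) (C : Set K.Cell) (σ : K.Cell) : ℕ∞ :=
  (K.UCset f C σ).encard

/-- `D^C(σ)`. -/
noncomputable def DC (f : K.Cell → ℝ) (C : Set K.Cell) (σ : K.Cell) : ℕ∞ :=
  (K.DCset f C σ).encard

/-- `f` is a discrete Morse–Bott function. -/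
def DiscreteMorseBott (f : K.Cell → ℝ) : Prop :=
  ∀ C : Set K.Cell, K.IsCollection f C → ∀ σ ∈ C,
    (∀ τ, K.IrregularFace σ τ → f σ < f τ) ∧
    K.UC f C σ ≤ 1 ∧
    (∀ ν, K.IrregularFace ν σ → f ν < f σ) ∧
    K.DC f C σ ≤ 1

/-- The reduced collection `C^red`: delete from `C` all upward noncritical cells
(those with `U^C(σ) = 1`) and all downward noncritical cells (those with `D^C(σ) = 1`). -/
def red (f : K.Cell → ℝ) (C : Set K.Cell) : Set K.Cell :=
  {σ ∈ C | K.UC f C σ ≠ 1 ∧ K.DC f C σ ≠ 1}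

end CWComplexCells


theorem bw_det_poly {n : ℕ} (A : EuclideanSpace ℝ (Fin n) →L[ℝ] EuclideanSpace ℝ (Fin n)) :
    ∃ P : Polynomial ℝ, P.natDegree ≤ n ∧ ∀ t : ℝ, P.eval t = (1 + t • A).det := by
  classical
  let b := (EuclideanSpace.basisFun (Fin n) ℝ).toBasis
  let M := LinearMap.toMatrix b b (A : EuclideanSpace ℝ (Fin n) →ₗ[ℝ] EuclideanSpace ℝ (Fin n))
  refine ⟨Matrix.det ((Polynomial.X : Polynomial ℝ) • M.map Polynomial.C
    + (1 : Matrix (Fin n) (Fin n) ℝ).map Polynomial.C), ?_, ?_⟩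
  · simpa using Polynomial.natDegree_det_X_add_C_le M 1
  · intro t
    have h1 : (1 + t • A).det = Matrix.det (t • M + 1) := by
      rw [ContinuousLinearMap.det, ← LinearMap.det_toMatrix b]
      congr 1
      simp only [ContinuousLinearMap.toLinearMap_add, ContinuousLinearMap.toLinearMap_smul, map_add,
        map_smul]
      rw [add_comm]
      congr 1
      exact LinearMap.toMatrix_one b
    rw [h1, ← Polynomial.coe_evalRingHom, RingHom.map_det]
    congr 1
    ext i j
    by_cases hij : i = j
    · simp [hij]; ring
    · simp [hij]; ring

theorem bw_det_ne {n : ℕ} (A : EuclideanSpace ℝ (Fin n) →L[ℝ] EuclideanSpace ℝ (Fin n))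
    (hA : ‖A‖ < 1) : (1 + A).det ≠ 0 := by
  intro h
  have h2 : LinearMap.ker ((1 + A : EuclideanSpace ℝ (Fin n) →L[ℝ] EuclideanSpace ℝ (Fin n)) :
      EuclideanSpace ℝ (Fin n) →ₗ[ℝ] EuclideanSpace ℝ (Fin n)) ≠ ⊥ := by
    have := LinearMap.bot_lt_ker_of_det_eq_zero h
    exact this.ne'
  obtain ⟨x, hx, hx0⟩ := Submodule.exists_mem_ne_zero_of_ne_bot h2
  have h3 : x + A x = 0 := by simpa using hx
  have h4 : ‖x‖ = ‖A x‖ := by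
    have h7 : ‖x‖ = ‖-(A x)‖ := congrArg norm (eq_neg_of_add_eq_zero_left h3)
    rw [h7, norm_neg]
  have h5 := A.le_opNorm x
  have h6 : 0 < ‖x‖ := norm_pos_iff.2 hx0
  nlinarith

theorem bw_det_pos {n : ℕ} (A : EuclideanSpace ℝ (Fin n) →L[ℝ] EuclideanSpace ℝ (Fin n))
    (hA : ‖A‖ < 1) : 0 < (1 + A).det := by
  by_contra hneg
  push Not at hneg
  have hc : ContinuousOn (fun s : ℝ => (1 + s • A).det) (Icc 0 1) := by
    apply Continuous.continuousOn
    apply ContinuousLinearMap.continuous_det.comp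
    fun_prop
  have := intermediate_value_Icc' (zero_le_one) hc
  have h0 : (0:ℝ) ∈ Icc ((1 + (1:ℝ) • A).det) ((1 + (0:ℝ) • A).det) := by
    constructor
    · simpa using hneg
    · simp [ContinuousLinearMap.det]
  obtain ⟨s, hs, hs0⟩ := this h0
  refine bw_det_ne (s • A) ?_ hs0
  rw [norm_smul, Real.norm_of_nonneg hs.1]
  nlinarith [hs.2, norm_nonneg A, hs.1]

theorem bw_int_small {n : ℕ} (R : ℝ) (v : EuclideanSpace ℝ (Fin n) → EuclideanSpace ℝ (Fin n))
    (v' : EuclideanSpace ℝ (Fin n) → EuclideanSpace ℝ (Fin n) →L[ℝ] EuclideanSpace ℝ (Fin n))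
    (K : NNReal) (hv : LipschitzWith K v) (hv0 : ∀ x, R ≤ ‖x‖ → v x = 0)
    (hd : ∀ x ∈ ball (0 : EuclideanSpace ℝ (Fin n)) R, HasFDerivAt v (v' x) x)
    (t : NNReal) (ht : t * K < 1) :
    ∫ x in ball (0 : EuclideanSpace ℝ (Fin n)) R, (1 + (t : ℝ) • v' x).det
      = MeasureTheory.volume.real (ball (0 : EuclideanSpace ℝ (Fin n)) R) := by
  set f : EuclideanSpace ℝ (Fin n) → EuclideanSpace ℝ (Fin n) := fun x => x + (t : ℝ) • v x
  have happ : ApproximatesLinearOn f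
      ((ContinuousLinearEquiv.refl ℝ (EuclideanSpace ℝ (Fin n)) :
        EuclideanSpace ℝ (Fin n) ≃L[ℝ] EuclideanSpace ℝ (Fin n)) :
        EuclideanSpace ℝ (Fin n) →L[ℝ] EuclideanSpace ℝ (Fin n)) univ (t * K) := by
    rw [ApproximatesLinearOn]
    intro x _ y _
    have h1 : f x - f y - ((ContinuousLinearEquiv.refl ℝ (EuclideanSpace ℝ (Fin n)) :
        EuclideanSpace ℝ (Fin n) ≃L[ℝ] EuclideanSpace ℝ (Fin n)) :
        EuclideanSpace ℝ (Fin n) →L[ℝ] EuclideanSpace ℝ (Fin n)) (x - y)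
        = (t : ℝ) • (v x - v y) := by
      simp only [f, ContinuousLinearEquiv.coe_refl, ContinuousLinearMap.id_apply, smul_sub]
      abel
    rw [h1, norm_smul, NNReal.coe_mul, mul_assoc]
    have := hv.norm_sub_le x y
    simp only [Real.norm_eq_abs, NNReal.abs_eq]
    gcongr
  have hc : Subsingleton (EuclideanSpace ℝ (Fin n)) ∨ t * K <
      ‖((ContinuousLinearEquiv.refl ℝ (EuclideanSpace ℝ (Fin n))).symm :
        EuclideanSpace ℝ (Fin n) →L[ℝ] EuclideanSpace ℝ (Fin n))‖₊⁻¹ := by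
    rcases subsingleton_or_nontrivial (EuclideanSpace ℝ (Fin n)) with h | h
    · exact Or.inl h
    · right
      have : ‖((ContinuousLinearEquiv.refl ℝ (EuclideanSpace ℝ (Fin n))).symm :
        EuclideanSpace ℝ (Fin n) →L[ℝ] EuclideanSpace ℝ (Fin n))‖₊ = 1 := by
        ext
        simp
      rw [this]; simpa using ht
  have hsurj := happ.surjective hc
  have hinj : Function.Injective f := by
    have := happ.injOn hc
    exact injOn_univ.1 this
  have himg : f '' ball 0 R = ball 0 R := by
    have h1 : f '' (ball 0 R)ᶜ = (ball 0 R)ᶜ := by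
      have : ∀ x ∈ (ball (0 : EuclideanSpace ℝ (Fin n)) R)ᶜ, f x = x := by
        intro x hx
        have : R ≤ ‖x‖ := by simpa using hx
        simp [f, hv0 x this]
      rw [Set.image_congr this, image_id']
    rw [Set.image_compl_eq ⟨hinj, hsurj⟩] at h1
    exact compl_injective h1
  have hlip : ∀ x ∈ ball (0 : EuclideanSpace ℝ (Fin n)) R, ‖v' x‖ ≤ K := fun x hx =>
    (hd x hx).le_of_lipschitz hv
  have hcv := MeasureTheory.integral_image_eq_integral_abs_det_fderiv_smul
    (MeasureTheory.volume) (measurableSet_ball (x := (0 : EuclideanSpace ℝ (Fin n))) (ε := R))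
    (f := f) (f' := fun x => 1 + (t : ℝ) • v' x)
    (fun x hx => by
      have := (hasFDerivAt_id x).add ((hd x hx).const_smul (t : ℝ))
      exact this.hasFDerivWithinAt) hinj.injOn (fun _ => (1 : ℝ))
  rw [himg] at hcv
  have h2 : ∫ x in ball (0 : EuclideanSpace ℝ (Fin n)) R, (1 : ℝ)
      = MeasureTheory.volume.real (ball (0 : EuclideanSpace ℝ (Fin n)) R) := by simp
  rw [← h2, hcv]
  apply MeasureTheory.setIntegral_congr_fun measurableSet_ball
  intro x hx
  have : 0 < (1 + (t : ℝ) • v' x).det := by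
    apply bw_det_pos
    rw [norm_smul]
    simp only [Real.norm_eq_abs, NNReal.abs_eq]
    have h3 : (t : ℝ) * K < 1 := by exact_mod_cast ht
    have := hlip x hx
    calc (t : ℝ) * ‖v' x‖ ≤ t * K := by gcongr
      _ < 1 := h3
  simp [abs_of_pos this]

theorem bw_int_one {n : ℕ} (R : ℝ) (v : EuclideanSpace ℝ (Fin n) → EuclideanSpace ℝ (Fin n))
    (v' : EuclideanSpace ℝ (Fin n) → EuclideanSpace ℝ (Fin n) →L[ℝ] EuclideanSpace ℝ (Fin n))
    (K : NNReal) (hv : LipschitzWith K v) (hv0 : ∀ x, R ≤ ‖x‖ → v x = 0)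
    (hd : ∀ x ∈ ball (0 : EuclideanSpace ℝ (Fin n)) R, HasFDerivAt v (v' x) x)
    (hcont : Continuous v') :
    ∫ x in ball (0 : EuclideanSpace ℝ (Fin n)) R, (1 + v' x).det
      = MeasureTheory.volume.real (ball (0 : EuclideanSpace ℝ (Fin n)) R) := by
  let s : Finset ℕ := Finset.range (n + 1)
  let w : ℕ → ℝ := fun i => ((i : ℝ) + 1)⁻¹ * ((K : ℝ) + 1)⁻¹
  have hK : (0 : ℝ) < K + 1 := by positivity
  have hw : InjOn w s := by
    intro i _ j _ hij
    have h1 : ((i : ℝ) + 1)⁻¹ = ((j : ℝ) + 1)⁻¹ := mul_right_cancel₀ (inv_ne_zero hK.ne') hij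
    have h2 := inv_injective h1
    exact_mod_cast add_right_cancel h2
  have hint : ∀ i ∈ s, ∫ x in ball (0 : EuclideanSpace ℝ (Fin n)) R, (1 + w i • v' x).det
      = MeasureTheory.volume.real (ball (0 : EuclideanSpace ℝ (Fin n)) R) := by
    intro i _
    have h0 : 0 ≤ w i := by positivity
    have := bw_int_small R v v' K hv hv0 hd (w i).toNNReal (by
      rw [← NNReal.coe_lt_coe, NNReal.coe_mul]
      rw [Real.coe_toNNReal _ h0]
      simp only [w, NNReal.coe_one]
      have h3 : ((i : ℝ) + 1)⁻¹ ≤ 1 := inv_le_one_of_one_le₀ (by linarith [Nat.cast_nonneg (α := ℝ) i])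
      have h4 : ((K : ℝ) + 1)⁻¹ * K < 1 := by
        rw [inv_mul_lt_iff₀ hK]; linarith
      have h5 : 0 ≤ ((K : ℝ) + 1)⁻¹ * K := by positivity
      rw [mul_assoc]
      nlinarith)
    rw [Real.coe_toNNReal _ h0] at this
    exact this
  have hdet : ∀ x, (1 + v' x).det
      = ∑ i ∈ s, (1 + w i • v' x).det * (Lagrange.basis s w i).eval 1 := by
    intro x
    obtain ⟨P, hP, hPe⟩ := bw_det_poly (v' x)
    have h1 : P = _ := Lagrange.eq_interpolate (s := s) (v := w) hw (f := P) (by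
      rw [Finset.card_range]
      refine lt_of_le_of_lt Polynomial.degree_le_natDegree ?_
      exact_mod_cast Nat.lt_succ_of_le hP)
    have h2 : (1 + v' x).det = P.eval 1 := by rw [hPe]; simp
    rw [h2, h1, Lagrange.interpolate_apply, Polynomial.eval_finsetSum]
    apply Finset.sum_congr rfl
    intro i _
    rw [Polynomial.eval_mul, Polynomial.eval_C, hPe]
  have hsum : ∑ i ∈ s, (Lagrange.basis s w i).eval 1 = 1 := by
    rw [← Polynomial.eval_finsetSum, Lagrange.sum_basis hw ⟨0, by simp [s]⟩, Polynomial.eval_one]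
  simp_rw [hdet]
  rw [MeasureTheory.integral_finsetSum]
  · have h7 : MeasureTheory.volume.real (ball (0 : EuclideanSpace ℝ (Fin n)) R)
        = ∑ i ∈ s, (Lagrange.basis s w i).eval 1 *
          MeasureTheory.volume.real (ball (0 : EuclideanSpace ℝ (Fin n)) R) := by
      rw [← Finset.sum_mul, hsum, one_mul]
    rw [h7]
    apply Finset.sum_congr rfl
    intro i hi
    rw [MeasureTheory.integral_mul_const, hint i hi, mul_comm]
  · intro i _
    apply MeasureTheory.Integrable.mul_const
    have hcd : Continuous (fun x => (1 + w i • v' x).det) := by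
      apply ContinuousLinearMap.continuous_det.comp
      fun_prop
    exact ((hcd.continuousOn.integrableOn_compact (isCompact_closedBall 0 R))).mono_set
      ball_subset_closedBall

theorem bw_no_retract {n : ℕ} (R : ℝ) (hR : 0 < R)
    (N : EuclideanSpace ℝ (Fin n) → EuclideanSpace ℝ (Fin n)) (hN : ContDiff ℝ 1 N)
    (hnorm : ∀ x, ‖N x‖ = R) (hid : ∀ x, ‖x‖ = R → N x = x) : False := by
  classical
  let w : EuclideanSpace ℝ (Fin n) → EuclideanSpace ℝ (Fin n) := fun x => N x - x
  have hw : ContDiff ℝ 1 w := hN.sub contDiff_id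
  let v : EuclideanSpace ℝ (Fin n) → EuclideanSpace ℝ (Fin n) :=
    fun x => if ‖x‖ ≤ R then w x else 0
  have hw0 : ∀ x, ‖x‖ = R → w x = 0 := fun x hx => by simp [w, hid x hx]
  obtain ⟨K, hK⟩ : ∃ K : NNReal, LipschitzOnWith K w (closedBall 0 R) :=
    hw.contDiffOn.exists_lipschitzOnWith one_ne_zero (convex_closedBall 0 R) (isCompact_closedBall 0 R)
  have hv0 : ∀ x, R ≤ ‖x‖ → v x = 0 := by
    intro x hx
    by_cases h : ‖x‖ ≤ R
    · simp only [v, h, if_true]; exact hw0 x (le_antisymm h hx)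
    · simp [v, h]
  have hcross : ∀ x y, ‖x‖ ≤ R → R ≤ ‖y‖ → dist (v x) (v y) ≤ K * dist x y := by
    intro x y hx hy
    have hc : ContinuousOn (fun s : ℝ => ‖AffineMap.lineMap x y s‖) (Icc 0 1) := by
      apply Continuous.continuousOn
      exact (AffineMap.lineMap_continuous).norm
    obtain ⟨s, hs, hsR⟩ := intermediate_value_Icc zero_le_one hc
      (show R ∈ Icc _ _ by simpa using ⟨hx, hy⟩)
    simp only at hsR
    set z := AffineMap.lineMap x y s with hz
    have h1 : dist (w x) (w z) ≤ K * dist x z :=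
      hK.dist_le_mul x (by simpa using hx) z (by simp [hsR])
    have h2 : dist x z ≤ dist x y := by
      rw [hz, dist_left_lineMap, Real.norm_of_nonneg hs.1]
      nlinarith [hs.2, dist_nonneg (x := x) (y := y)]
    rw [hv0 y hy]
    simp only [v, hx, if_true]
    rw [hw0 z hsR] at h1
    exact h1.trans (by gcongr)
  have hv : LipschitzWith K v := by
    apply LipschitzWith.of_dist_le_mul
    intro x y
    rcases le_total ‖x‖ R with hx | hx <;> rcases le_total ‖y‖ R with hy | hy
    · simp only [v, hx, hy, if_true]
      exact hK.dist_le_mul x (by simpa using hx) y (by simpa using hy)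
    · exact hcross x y hx hy
    · rw [dist_comm, dist_comm x y]; exact hcross y x hy hx
    · rw [hv0 x hx, hv0 y hy, dist_self]; positivity
  have hd : ∀ x ∈ ball (0 : EuclideanSpace ℝ (Fin n)) R, HasFDerivAt v (fderiv ℝ w x) x := by
    intro x hx
    have h1 : HasFDerivAt w (fderiv ℝ w x) x := (hw.differentiable one_ne_zero x).hasFDerivAt
    refine h1.congr_of_eventuallyEq ?_
    filter_upwards [isOpen_ball.mem_nhds hx] with y hy
    have : ‖y‖ ≤ R := by simpa using (mem_ball_zero_iff.1 hy).le
    simp [v, this]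
  have hmain := bw_int_one R v (fderiv ℝ w) K hv hv0 hd (hw.continuous_fderiv one_ne_zero)
  have hz : ∀ x, (1 + fderiv ℝ w x).det = 0 := by
    intro x
    have h1 : HasFDerivAt N (1 + fderiv ℝ w x) x := by
      have h2 := (hasFDerivAt_id x).add (hw.differentiable one_ne_zero x).hasFDerivAt
      refine h2.congr_of_eventuallyEq (Filter.Eventually.of_forall fun y => ?_)
      simp [w]
    have h3 := h1.norm_sq
    have h4 : (fun y => ‖N y‖ ^ 2) = fun _ => R ^ 2 := by ext y; rw [hnorm]
    rw [h4] at h3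
    have h5 := h3.unique (hasFDerivAt_const _ _)
    by_contra hne
    have hsurj : Function.Surjective
        (1 + fderiv ℝ w x : EuclideanSpace ℝ (Fin n) →L[ℝ] EuclideanSpace ℝ (Fin n)) := by
      have := ((1 + fderiv ℝ w x).toContinuousLinearEquivOfDetNeZero hne).surjective
      exact this
    obtain ⟨y, hy⟩ := hsurj (N x)
    have h6 := congrArg (fun L => L y) h5
    simp only [smul_apply, ContinuousLinearMap.comp_apply, hy] at h6
    simp at h6
    have := hnorm x
    rw [h6] at this
    simp at this
    linarith
  simp only [hz, MeasureTheory.integral_zero] at hmain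
  have hpos : 0 < MeasureTheory.volume.real (ball (0 : EuclideanSpace ℝ (Fin n)) R) :=
    ENNReal.toReal_pos (Metric.measure_ball_pos _ _ hR).ne'
      MeasureTheory.measure_ball_lt_top.ne
  linarith

theorem bw_boundary {n : ℕ} (F : EuclideanSpace ℝ (Fin n) → EuclideanSpace ℝ (Fin n))
    (hF : ContinuousOn F (closedBall 0 1)) (hF0 : ∀ x ∈ closedBall (0 : EuclideanSpace ℝ (Fin n)) 1,
      F x ≠ 0)
    (hb : ∀ x : EuclideanSpace ℝ (Fin n), ‖x‖ = 1 → ∀ c : ℝ, 0 ≤ c → F x + c • x ≠ 0) : False := by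
  classical
  -- radial projection on the closed ball
  let q : EuclideanSpace ℝ (Fin n) → EuclideanSpace ℝ (Fin n) := fun x => (max 1 ‖x‖)⁻¹ • x
  have hqc : Continuous q := by
    have h1 : Continuous (fun x : EuclideanSpace ℝ (Fin n) => (max 1 ‖x‖)⁻¹) := by
      apply Continuous.inv₀ (by fun_prop)
      intro x
      positivity
    exact h1.smul continuous_id
  have hqn : ∀ x, q x ∈ closedBall (0 : EuclideanSpace ℝ (Fin n)) 1 := by
    intro x
    have h1 : 0 < max 1 ‖x‖ := by positivity
    simp only [q, mem_closedBall_zero_iff, norm_smul, norm_inv, Real.norm_eq_abs, abs_of_pos h1]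
    rw [inv_mul_le_iff₀ h1]; simp
  let s : EuclideanSpace ℝ (Fin n) → ℝ := fun x => max 0 (min 1 (‖x‖ - 1))
  have hsc : Continuous s := by fun_prop
  let G : EuclideanSpace ℝ (Fin n) → EuclideanSpace ℝ (Fin n) :=
    fun x => (1 - s x) • F (q x) + s x • x
  have hGc : Continuous G := by
    have : Continuous (fun x => F (q x)) := hF.comp_continuous hqc hqn
    exact ((continuous_const.sub hsc).smul this).add (hsc.smul continuous_id)
  have hG2 : ∀ x, 2 ≤ ‖x‖ → G x = x := by
    intro x hx
    have : s x = 1 := by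
      simp only [s]; rw [min_eq_left (by linarith)]; simp
    simp [G, this]
  have hG0 : ∀ x, G x ≠ 0 := by
    intro x
    rcases le_total ‖x‖ 1 with h | h
    · have : s x = 0 := by
        simp only [s]; rw [max_eq_left]; exact (min_le_right _ _).trans (by linarith)
      simp only [G, this, sub_zero, one_smul, zero_smul, add_zero]
      exact hF0 _ (hqn x)
    · rcases le_total 2 ‖x‖ with h2 | h2
      · rw [hG2 x h2]; intro h3; rw [h3] at h2; simp at h2; linarith
      · rcases eq_or_lt_of_le h2 with h3 | h3
        · rw [hG2 x h3.ge]; intro h4; rw [h4] at h3; simp at h3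
        · have hs1 : s x = ‖x‖ - 1 := by
            simp only [s]; rw [min_eq_right (by linarith), max_eq_right (by linarith)]
          have hxp : 0 < ‖x‖ := by linarith
          have hq1 : q x = ‖x‖⁻¹ • x := by simp only [q]; rw [max_eq_right h]
          have hqn1 : ‖q x‖ = 1 := by
            rw [hq1, norm_smul, norm_inv, norm_norm]; exact inv_mul_cancel₀ hxp.ne'
          have hx2 : x = ‖x‖ • q x := by rw [hq1, smul_inv_smul₀ hxp.ne']
          have hp : 0 < 1 - s x := by rw [hs1]; linarith
          have hs0 : 0 ≤ s x := by rw [hs1]; linarith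
          intro h4
          refine hb (q x) hqn1 ((1 - s x)⁻¹ * (s x * ‖x‖)) (by positivity) ?_
          have h5 : (1 - s x)⁻¹ • G x = F (q x) + ((1 - s x)⁻¹ * (s x * ‖x‖)) • q x := by
            simp only [G]
            rw [smul_add, inv_smul_smul₀ hp.ne', mul_smul, mul_smul, ← hx2]
          rw [← h5, h4, smul_zero]
  let t : EuclideanSpace ℝ (Fin n) → Set (EuclideanSpace ℝ (Fin n)) :=
    fun y => ball (G y - y) ‖G y‖ ∩ {w | 3 ≤ ‖y‖ → w = 0}
  obtain ⟨g, hg⟩ := exists_contMDiffMap_forall_mem_convex_of_local_const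
    (n := 1) (modelWithCornersSelf ℝ (EuclideanSpace ℝ (Fin n))) (t := t) (by
      intro y
      apply (convex_ball _ _).inter
      intro a ha b hb' c d _ _ _ h3
      simp [ha h3, hb' h3]) (by
      intro x
      rcases lt_or_ge 2 ‖x‖ with h | h
      · refine ⟨0, ?_⟩
        filter_upwards [(isOpen_lt continuous_const continuous_norm).mem_nhds h] with y hy
        have hy : 2 < ‖y‖ := hy
        refine ⟨?_, fun _ => rfl⟩
        rw [hG2 y hy.le]
        rw [sub_self]
        exact mem_ball_self (by linarith)
      · refine ⟨G x - x, ?_⟩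
        have h1 : ∀ᶠ y in nhds x, ‖y‖ < 3 :=
          (isOpen_lt continuous_norm continuous_const).mem_nhds (by
            show ‖x‖ < 3
            linarith)
        have h2 : ∀ᶠ y in nhds x, dist (G x - x) (G y - y) < ‖G y‖ := by
          apply (isOpen_lt (by fun_prop) (by fun_prop)).mem_nhds
          simpa using hG0 x
        filter_upwards [h1, h2] with y hy1 hy2
        exact ⟨hy2, fun h3 => absurd hy1 (not_lt.2 h3)⟩)
  have hgs : ContDiff ℝ 1 g := g.contMDiff.contDiff
  have hH0 : ∀ x, x + g x ≠ 0 := by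
    intro x h
    have h1 := (hg x).1
    rw [mem_ball, dist_eq_norm] at h1
    have h2 : g x - (G x - x) = - G x := by
      rw [eq_neg_of_add_eq_zero_right h]; abel
    rw [h2, norm_neg] at h1
    exact lt_irrefl _ h1
  refine bw_no_retract 3 (by norm_num) (fun x => ((3 : ℝ) * ‖x + g x‖⁻¹) • (x + g x)) ?_ ?_ ?_
  · have hs : ContDiff ℝ 1 (fun x => x + g x) := contDiff_id.add hgs
    have h1 : ContDiff ℝ 1 (fun x => (3 : ℝ) * ‖x + g x‖⁻¹) :=
      contDiff_const.mul ((hs.norm ℝ hH0).inv (fun x => norm_ne_zero_iff.2 (hH0 x)))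
    exact h1.smul hs
  · intro x
    have := norm_pos_iff.2 (hH0 x)
    rw [norm_smul, norm_mul, norm_inv, norm_norm, mul_assoc, inv_mul_cancel₀ this.ne']
    norm_num
  · intro x hx
    have : g x = 0 := (hg x).2 hx.ge
    simp [this, hx]

theorem tp_quot {A X T : Type*} [TopologicalSpace A] [TopologicalSpace X] [T2Space X]
    [TopologicalSpace T] {D : Set A} (hD : IsCompact D) {φ : A → X} (hφ : ContinuousOn φ D)
    {S : Set X} (hS : S ⊆ φ '' D) {h : X → T}
    (hh : ContinuousOn (fun a => h (φ a)) (D ∩ φ ⁻¹' S)) : ContinuousOn h S := by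
  rw [continuousOn_iff_isClosed] at hh ⊢
  intro t ht
  obtain ⟨u, hu, hu2⟩ := hh t ht
  refine ⟨φ '' (D ∩ u), ((hD.inter_right hu).image_of_continuousOn
    (hφ.mono inter_subset_left)).isClosed, ?_⟩
  ext x
  constructor
  · rintro ⟨hx, hxS⟩
    obtain ⟨d, hd, rfl⟩ := hS hxS
    have : d ∈ u ∩ (D ∩ φ ⁻¹' S) := by
      rw [← hu2]; exact ⟨hx, hd, hxS⟩
    exact ⟨⟨d, ⟨hd, this.1⟩, rfl⟩, hxS⟩
  · rintro ⟨⟨d, ⟨hd, hdu⟩, rfl⟩, hxS⟩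
    have : d ∈ (fun a => h (φ a)) ⁻¹' t ∩ (D ∩ φ ⁻¹' S) := by
      rw [hu2]; exact ⟨hdu, hd, hxS⟩
    exact ⟨this.1, hxS⟩

theorem tp_ext {A P : Type} [TopologicalSpace A] [NormalSpace A] [NormedAddCommGroup P]
    [InnerProductSpace ℝ P] [FiniteDimensional ℝ P] (q : sphere (0 : P) 1) {S : Set A}
    (hS : IsClosed S) (β : A → sphere (0 : P) 1) (hβ : ContinuousOn β S)
    (hq : ∀ x ∈ S, β x ≠ q) :
    ∃ β' : A → sphere (0 : P) 1, Continuous β' ∧ (∀ x, β' x ≠ q) ∧ ∀ x ∈ S, β' x = β x := by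
  have hq1 : ‖(q : P)‖ = 1 := by simp
  let st := stereographic hq1
  have hsrc : st.source = {q}ᶜ := by simp [st, stereographic_source]
  have htgt : st.target = univ := stereographic_target hq1
  let f : C(S, (ℝ ∙ (q : P))ᗮ) := ⟨fun x => st (β x), by
    have h1 : ContinuousOn (fun x => st (β x)) S := by
      refine st.continuousOn.comp hβ ?_
      intro x hx
      rw [hsrc]
      exact hq x hx
    exact continuousOn_iff_continuous_domRestrict.1 h1⟩
  obtain ⟨g, hg⟩ := f.exists_restrict_eq hS
  refine ⟨fun x => st.symm (g x), ?_, ?_, ?_⟩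
  · have h1 : ContinuousOn st.symm univ := htgt ▸ st.continuousOn_symm
    exact (continuousOn_univ.1 h1).comp g.continuous
  · intro x
    have : st.symm (g x) ∈ st.source := st.map_target (by rw [htgt]; trivial)
    rw [hsrc] at this
    exact this
  · intro x hx
    have h1 : g x = st (β x) := congrArg (fun k : C(S, (ℝ ∙ (q : P))ᗮ) => k ⟨x, hx⟩) hg
    simp only [h1]
    exact st.left_inv (by rw [hsrc]; exact hq x hx)

theorem tp_retr {E : Type*} [NormedAddCommGroup E] [InnerProductSpace ℝ E] (z₀ : E)
    (hz : ‖z₀‖ < 1) :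
    ∃ r : E → E, ContinuousOn r {z₀}ᶜ ∧ (∀ z, z ≠ z₀ → ‖r z‖ = 1) ∧
      ∀ z, ‖z‖ = 1 → ∀ s : ℝ, 0 < s → r (z₀ + s • (z - z₀)) = z := by
  let a : E → ℝ := fun z => ‖z - z₀‖ ^ 2
  let b : E → ℝ := fun z => inner ℝ z₀ (z - z₀)
  let c : ℝ := 1 - ‖z₀‖ ^ 2
  have hc : 0 < c := by
    have := norm_nonneg z₀
    simp only [c]; nlinarith
  let t : E → ℝ := fun z => (-b z + Real.sqrt (b z ^ 2 + a z * c)) / a z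
  have ha : ∀ z, z ≠ z₀ → 0 < a z := fun z h => by
    have : 0 < ‖z - z₀‖ := norm_pos_iff.2 (sub_ne_zero.2 h)
    positivity
  refine ⟨fun z => z₀ + t z • (z - z₀), ?_, ?_, ?_⟩
  · have hac : Continuous a := by fun_prop
    have hbc : Continuous b := by fun_prop
    have htc : ContinuousOn t {z₀}ᶜ := by
      apply ContinuousOn.div
      · fun_prop
      · fun_prop
      · intro x hx; exact (ha x hx).ne'
    fun_prop
  · intro z h
    have h1 : ‖z₀ + t z • (z - z₀)‖ ^ 2 = 1 := by
      rw [norm_add_sq_real, inner_smul_right, norm_smul, mul_pow, Real.norm_eq_abs, sq_abs]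
      change ‖z₀‖ ^ 2 + 2 * (t z * b z) + t z ^ 2 * a z = 1
      have hp := ha z h
      have hs : Real.sqrt (b z ^ 2 + a z * c) ^ 2 = b z ^ 2 + a z * c :=
        Real.sq_sqrt (by positivity)
      have ht : t z * a z = -b z + Real.sqrt (b z ^ 2 + a z * c) := by
        simp only [t]; exact div_mul_cancel₀ _ hp.ne'
      have h2 : a z * (t z ^ 2 * a z + 2 * (t z * b z) - c) = 0 := by
        have : (t z * a z + b z) ^ 2 = b z ^ 2 + a z * c := by
          rw [show t z * a z + b z = Real.sqrt (b z ^ 2 + a z * c) by linarith, hs]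
        nlinarith
      have h3 := (mul_eq_zero.1 h2).resolve_left hp.ne'
      simp only [c] at h3
      linarith
    have := norm_nonneg (z₀ + t z • (z - z₀))
    nlinarith
  · intro z h s hs
    have hne : z ≠ z₀ := by rintro rfl; linarith
    have hp := ha z hne
    have h1 : a z + 2 * b z = c := by
      have h2 : ‖z₀ + (z - z₀)‖ ^ 2 = 1 := by rw [add_sub_cancel, h]; norm_num
      rw [norm_add_sq_real] at h2
      simp only [a, b, c]; linarith
    have has : a (z₀ + s • (z - z₀)) = s ^ 2 * a z := by
      simp only [a, add_sub_cancel_left, norm_smul, mul_pow, Real.norm_eq_abs, sq_abs]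
    have hbs : b (z₀ + s • (z - z₀)) = s * b z := by
      simp only [b, add_sub_cancel_left, inner_smul_right]
    have hts : t (z₀ + s • (z - z₀)) = s⁻¹ := by
      simp only [t, has, hbs]
      have h3 : (s * b z) ^ 2 + s ^ 2 * a z * c = (s * (a z + b z)) ^ 2 := by
        rw [← h1]; ring
      rw [h3, Real.sqrt_sq (mul_nonneg hs.le (by linarith))]
      field_simp
      ring
    simp only [hts, add_sub_cancel_left]
    rw [inv_smul_smul₀ hs.ne', add_sub_cancel]

open Classical in
theorem tp_collapse {A Y : Type*} [TopologicalSpace A] [TopologicalSpace Y] [T2Space Y]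
    (j : A → Y) (hj : Topology.IsOpenEmbedding j) :
    ∃ κ : Y → OnePoint A, Continuous κ ∧ (∀ a, κ (j a) = (a : OnePoint A)) ∧
      ∀ y, y ∉ range j → κ y = OnePoint.infty := by
  let κ : Y → OnePoint A := fun y => if h : ∃ a, j a = y then ((h.choose : A) : OnePoint A)
    else OnePoint.infty
  have h1 : ∀ a, κ (j a) = (a : OnePoint A) := by
    intro a
    have h : ∃ a', j a' = j a := ⟨a, rfl⟩
    simp only [κ, dif_pos h]
    rw [hj.injective h.choose_spec]
  have h2 : ∀ y, y ∉ range j → κ y = OnePoint.infty := by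
    intro y hy
    have h : ¬ ∃ a, j a = y := hy
    simp only [κ, dif_neg h]
  refine ⟨κ, ?_, h1, h2⟩
  rw [continuous_def]
  intro s hs
  by_cases hi : OnePoint.infty ∈ s
  · have hK := (OnePoint.isOpen_iff_of_mem hi).1 hs
    have : κ ⁻¹' s = (j '' ((fun a : A => (a : OnePoint A)) ⁻¹' s)ᶜ)ᶜ := by
      ext y
      simp only [mem_preimage, mem_compl_iff, mem_image, not_exists, not_and]
      constructor
      · rintro hy a ha rfl
        rw [h1] at hy
        exact ha hy
      · intro hy
        by_cases hr : y ∈ range j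
        · obtain ⟨a, rfl⟩ := hr
          rw [h1]
          by_contra hc
          exact hy a hc rfl
        · rw [h2 y hr]; exact hi
    rw [this, isOpen_compl_iff]
    exact (hK.2.image hj.continuous).isClosed
  · have hK := (OnePoint.isOpen_iff_of_notMem hi).1 hs
    have : κ ⁻¹' s = j '' ((fun a : A => (a : OnePoint A)) ⁻¹' s) := by
      ext y
      constructor
      · intro hy
        by_cases hr : y ∈ range j
        · obtain ⟨a, rfl⟩ := hr
          rw [mem_preimage, h1] at hy
          exact ⟨a, hy, rfl⟩
        · rw [mem_preimage, h2 y hr] at hy; exact absurd hy hi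
      · rintro ⟨a, ha, rfl⟩
        rw [mem_preimage, h1]; exact ha
    rw [this]
    exact hj.isOpenMap _ hK

theorem tp_kappa (n : ℕ) :
    ∃ (κ : EuclideanSpace ℝ (Fin n) → sphere (0 : EuclideanSpace ℝ (Fin (n + 1))) 1)
      (q : sphere (0 : EuclideanSpace ℝ (Fin (n + 1))) 1),
      Continuous κ ∧ InjOn κ (ball 0 1) ∧ (∀ z ∈ ball (0 : EuclideanSpace ℝ (Fin n)) 1, κ z ≠ q) ∧
      (∀ z, z ∉ ball (0 : EuclideanSpace ℝ (Fin n)) 1 → κ z = q) ∧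
      ∀ t, t = q ∨ ∃ z ∈ ball (0 : EuclideanSpace ℝ (Fin n)) 1, κ z = t := by
  let j : EuclideanSpace ℝ (Fin n) → EuclideanSpace ℝ (Fin n) := fun x => (Homeomorph.unitBall x : _)
  have hj : Topology.IsOpenEmbedding j :=
    (isOpen_ball.isOpenEmbedding_subtypeVal).comp Homeomorph.unitBall.isOpenEmbedding
  have hr : range j = ball 0 1 := by
    ext y
    constructor
    · rintro ⟨x, rfl⟩
      exact (Homeomorph.unitBall x).2
    · intro hy
      exact ⟨Homeomorph.unitBall.symm ⟨y, hy⟩, by simp [j]⟩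
  obtain ⟨κ, hκ, h1, h2⟩ := tp_collapse j hj
  let e : OnePoint (EuclideanSpace ℝ (Fin n)) ≃ₜ sphere (0 : EuclideanSpace ℝ (Fin (n + 1))) 1 :=
    onePointEquivSphereOfFinrankEq (by simp)
  rw [← hr]
  refine ⟨fun z => e (κ z), e OnePoint.infty, e.continuous.comp hκ, ?_, ?_, ?_, ?_⟩
  · rintro _ ⟨a, rfl⟩ _ ⟨b, rfl⟩ h
    have := e.injective h
    rw [h1, h1] at this
    rw [OnePoint.coe_injective this]
  · rintro _ ⟨a, rfl⟩ h
    have := e.injective h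
    rw [h1] at this
    exact OnePoint.coe_ne_infty a this
  · intro z hz
    simp only [h2 z hz]
  · intro t
    obtain ⟨o, rfl⟩ := e.surjective t
    induction o using OnePoint.rec with
    | infty => exact Or.inl rfl
    | coe a => exact Or.inr ⟨j a, ⟨a, rfl⟩, by simp only [h1]⟩

theorem tp_cover {ι A T : Type*} [TopologicalSpace A] [TopologicalSpace T] {J : Set ι}
    (hJ : J.Finite) {F : ι → Set A} (hF : ∀ j ∈ J, IsClosed (F j)) {S : Set A}
    (hS : S ⊆ ⋃ j ∈ J, F j) {h : A → T} (hh : ∀ j ∈ J, ContinuousOn h (S ∩ F j)) :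
    ContinuousOn h S := by
  intro x hx
  have h1 : ∀ j ∈ J, ContinuousWithinAt h (S ∩ F j) x := by
    intro j hj
    by_cases hxj : x ∈ F j
    · exact hh j hj x ⟨hx, hxj⟩
    · apply continuousWithinAt_of_notMem_closure
      intro hc
      exact hxj ((hF j hj).closure_subset_iff.2 inter_subset_right hc)
  have h2 : ContinuousWithinAt h (⋃ j ∈ J, (S ∩ F j)) x := by
    unfold ContinuousWithinAt
    rw [nhdsWithin_biUnion hJ]
    exact Filter.tendsto_iSup.2 fun j => Filter.tendsto_iSup.2 fun hj => h1 j hj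
  refine h2.mono ?_
  intro y hy
  obtain ⟨j, hj, hyj⟩ := mem_iUnion₂.1 (hS hy)
  exact mem_iUnion₂.2 ⟨j, hj, hy, hyj⟩

section CWHelp

variable {X : Type} [TopologicalSpace X] [T2Space X] (K : CWComplexCells X)

theorem cw_uniq {σ τ : K.Cell} {x : X} (h1 : x ∈ K.cellSet σ) (h2 : x ∈ K.cellSet τ) : σ = τ := by
  by_contra h
  exact Set.disjoint_left.1 (K.cells_disjoint σ τ h) h1 h2

theorem cw_exists (x : X) : ∃ τ, x ∈ K.cellSet τ := by
  have : x ∈ (⋃ τ : K.Cell, K.charMap τ '' ball 0 1) := by rw [K.cells_cover]; trivial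
  exact mem_iUnion.1 this

theorem cw_compact (τ : K.Cell) : IsCompact (K.charMap τ '' closedBall 0 1) :=
  (isCompact_closedBall _ _).image_of_continuousOn (K.charMap_continuousOn τ)

theorem cw_compact_sphere (τ : K.Cell) : IsCompact (K.charMap τ '' sphere 0 1) :=
  (isCompact_sphere _ _).image_of_continuousOn
    ((K.charMap_continuousOn τ).mono sphere_subset_closedBall)

theorem cw_mem_or {τ : K.Cell} {z : EuclideanSpace ℝ (Fin (K.dim τ))} (hz : z ∈ closedBall 0 1) :
    z ∈ ball (0 : EuclideanSpace ℝ (Fin (K.dim τ))) 1 ∨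
      z ∈ sphere (0 : EuclideanSpace ℝ (Fin (K.dim τ))) 1 := by
  rw [← ball_union_sphere] at hz; exact hz

theorem cw_sub_closed (A : Set K.Cell)
    (hA : ∀ τ ∈ A, K.charMap τ '' sphere 0 1 ⊆ ⋃ σ ∈ A, K.cellSet σ) :
    IsClosed (⋃ σ ∈ A, K.cellSet σ) := by
  rw [K.isClosed_iff]
  have key : ∀ n, ∀ τ, K.dim τ = n →
      IsClosed ((⋃ σ ∈ A, K.cellSet σ) ∩ K.charMap τ '' closedBall 0 1) := by
    intro n
    induction n using Nat.strong_induction_on with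
    | _ n ih =>
      intro τ hτ
      by_cases hm : τ ∈ A
      · have : (⋃ σ ∈ A, K.cellSet σ) ∩ K.charMap τ '' closedBall 0 1 =
            K.charMap τ '' closedBall 0 1 := by
          apply inter_eq_right.2
          rintro _ ⟨z, hz, rfl⟩
          rcases cw_mem_or K hz with h | h
          · exact mem_iUnion₂.2 ⟨τ, hm, z, h, rfl⟩
          · exact hA τ hm ⟨z, h, rfl⟩
        rw [this]
        exact (cw_compact K τ).isClosed
      · obtain ⟨I, hI, hd, hs⟩ := K.sphere_subset τ
        have : (⋃ σ ∈ A, K.cellSet σ) ∩ K.charMap τ '' closedBall 0 1 =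
            K.charMap τ '' sphere 0 1 ∩
              ⋃ ρ ∈ I, ((⋃ σ ∈ A, K.cellSet σ) ∩ K.charMap ρ '' closedBall 0 1) := by
          ext x
          constructor
          · rintro ⟨hx, z, hz, rfl⟩
            rcases cw_mem_or K hz with h | h
            · exfalso
              obtain ⟨σ, hσ, hxσ⟩ := mem_iUnion₂.1 hx
              have := cw_uniq K hxσ (⟨z, h, rfl⟩ : K.charMap τ z ∈ K.cellSet τ)
              exact hm (this ▸ hσ)
            · have h1 : K.charMap τ z ∈ K.charMap τ '' sphere 0 1 := ⟨z, h, rfl⟩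
              refine ⟨h1, ?_⟩
              obtain ⟨ρ, hρ, hxρ⟩ := mem_iUnion₂.1 (hs h1)
              exact mem_iUnion₂.2 ⟨ρ, hρ, hx, image_mono ball_subset_closedBall hxρ⟩
          · rintro ⟨hx, hx2⟩
            obtain ⟨ρ, hρ, hxρ⟩ := mem_iUnion₂.1 hx2
            exact ⟨hxρ.1, image_mono sphere_subset_closedBall hx⟩
        rw [this]
        refine (cw_compact_sphere K τ).isClosed.inter ?_
        refine hI.isClosed_biUnion ?_
        intro ρ hρ
        exact ih (K.dim ρ) (hτ ▸ hd ρ hρ) ρ rfl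
  exact fun τ => key _ τ rfl

/-- The union of the cells of dimension less than `m`. -/
def cwSkel (m : ℕ) : Set X := ⋃ σ ∈ {σ : K.Cell | K.dim σ < m}, K.cellSet σ

theorem cw_mem_skel {m : ℕ} {τ : K.Cell} {x : X} (hx : x ∈ K.cellSet τ) :
    x ∈ cwSkel K m ↔ K.dim τ < m := by
  constructor
  · intro h
    obtain ⟨σ, hσ, hxσ⟩ := mem_iUnion₂.1 h
    rw [← cw_uniq K hxσ hx]
    exact hσ
  · intro h
    exact mem_iUnion₂.2 ⟨τ, h, hx⟩

theorem cw_sphere_skel (τ : K.Cell) : K.charMap τ '' sphere 0 1 ⊆ cwSkel K (K.dim τ) := by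
  obtain ⟨I, hI, hd, hs⟩ := K.sphere_subset τ
  intro x hx
  obtain ⟨ρ, hρ, hxρ⟩ := mem_iUnion₂.1 (hs hx)
  exact (cw_mem_skel K hxρ).2 (hd ρ hρ)

theorem cw_skel_mono {m n : ℕ} (h : m ≤ n) : cwSkel K m ⊆ cwSkel K n := by
  intro x hx
  obtain ⟨τ, hτ⟩ := cw_exists K x
  rw [cw_mem_skel K hτ] at hx ⊢
  omega

theorem cw_skel_closed (m : ℕ) : IsClosed (cwSkel K m) := by
  apply cw_sub_closed
  intro τ hτ
  exact (cw_sphere_skel K τ).trans (cw_skel_mono K (le_of_lt hτ))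

theorem cw_skel_diff_closed (ν : K.Cell) :
    IsClosed (cwSkel K (K.dim ν + 1) \ K.cellSet ν) := by
  have : cwSkel K (K.dim ν + 1) \ K.cellSet ν =
      ⋃ σ ∈ {σ : K.Cell | K.dim σ < K.dim ν + 1 ∧ σ ≠ ν}, K.cellSet σ := by
    ext x
    obtain ⟨τ, hτ⟩ := cw_exists K x
    constructor
    · rintro ⟨h1, h2⟩
      refine mem_iUnion₂.2 ⟨τ, ⟨(cw_mem_skel K hτ).1 h1, ?_⟩, hτ⟩
      rintro rfl
      exact h2 hτ
    · intro h
      obtain ⟨σ, hσ, hx⟩ := mem_iUnion₂.1 h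
      refine ⟨(cw_mem_skel K hx).2 hσ.1, fun h2 => hσ.2 (cw_uniq K hx h2)⟩
  rw [this]
  apply cw_sub_closed
  intro τ hτ x hx
  have h1 := cw_sphere_skel K τ hx
  obtain ⟨ρ, hρ⟩ := cw_exists K x
  rw [cw_mem_skel K hρ] at h1
  have := hτ.1
  refine mem_iUnion₂.2 ⟨ρ, ⟨by omega, ?_⟩, hρ⟩
  rintro rfl
  omega

theorem cw_face_mem {σ τ : K.Cell} (h : K.Face σ τ) {x : X} (hx : x ∈ K.cellSet σ) :
    ∃ y ∈ sphere (0 : EuclideanSpace ℝ (Fin (K.dim τ))) 1, K.charMap τ y = x := by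
  obtain ⟨h1, h2⟩ := h hx
  have h3 : x ∈ K.charMap τ '' closedBall 0 1 := by rw [← K.closure_cell]; exact h1
  obtain ⟨y, hy, rfl⟩ := h3
  rcases cw_mem_or K hy with hb | hb
  · exact absurd ⟨y, hb, rfl⟩ h2
  · exact ⟨y, hb, rfl⟩

theorem cw_inj {σ τ : K.Cell} (h : K.RegularFace σ τ) : InjOn (K.charMap τ) (K.preim σ τ) := by
  obtain ⟨-, ⟨e, he⟩, -⟩ := h
  intro x hx y hy hxy
  have : e ⟨x, hx⟩ = e ⟨y, hy⟩ := by
    apply Subtype.ext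
    rw [he, he]; exact hxy
  exact congrArg Subtype.val (e.injective this)

open Classical in
theorem cw_collapse (ν : K.Cell) :
    ∃ (c : X → sphere (0 : EuclideanSpace ℝ (Fin (K.dim ν + 1))) 1)
      (q : sphere (0 : EuclideanSpace ℝ (Fin (K.dim ν + 1))) 1),
      ContinuousOn c (cwSkel K (K.dim ν + 1)) ∧ InjOn c (K.cellSet ν) ∧
      (∀ x ∈ K.cellSet ν, c x ≠ q) ∧ (∀ x, x ∉ K.cellSet ν → c x = q) ∧
      ∀ t, t = q ∨ ∃ x ∈ K.cellSet ν, c x = t := by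
  obtain ⟨κ, q, hκ, hinj, hne, hq, hsurj⟩ := tp_kappa (K.dim ν)
  let c : X → sphere (0 : EuclideanSpace ℝ (Fin (K.dim ν + 1))) 1 := fun x =>
    if h : ∃ z ∈ ball (0 : EuclideanSpace ℝ (Fin (K.dim ν))) 1, K.charMap ν z = x
      then κ h.choose else q
  have hc1 : ∀ z ∈ ball (0 : EuclideanSpace ℝ (Fin (K.dim ν))) 1, c (K.charMap ν z) = κ z := by
    intro z hz
    have h : ∃ z' ∈ ball (0 : EuclideanSpace ℝ (Fin (K.dim ν))) 1,
      K.charMap ν z' = K.charMap ν z := ⟨z, hz, rfl⟩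
    simp only [c, dif_pos h]
    rw [K.charMap_injOn ν h.choose_spec.1 hz h.choose_spec.2]
  have hc2 : ∀ x, x ∉ K.cellSet ν → c x = q := by
    intro x hx
    have h : ¬ ∃ z ∈ ball (0 : EuclideanSpace ℝ (Fin (K.dim ν))) 1, K.charMap ν z = x := hx
    simp only [c, dif_neg h]
  have hc3 : ∀ z ∈ closedBall (0 : EuclideanSpace ℝ (Fin (K.dim ν))) 1,
      c (K.charMap ν z) = κ z := by
    intro z hz
    rcases cw_mem_or K hz with h | h
    · exact hc1 z h
    · have h1 := cw_sphere_skel K ν ⟨z, h, rfl⟩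
      rw [hc2, hq]
      · intro h2
        rw [mem_ball] at h2
        rw [mem_sphere] at h
        linarith
      · intro h2
        rw [cw_mem_skel K h2] at h1
        omega
  refine ⟨c, q, ?_, ?_, ?_, hc2, ?_⟩
  · have hA : ContinuousOn c (K.charMap ν '' closedBall 0 1) := by
      refine tp_quot (isCompact_closedBall _ _) (K.charMap_continuousOn ν) subset_rfl ?_
      refine (hκ.continuousOn).congr ?_
      intro z hz
      exact hc3 z hz.1
    have hB : ContinuousOn c (cwSkel K (K.dim ν + 1) \ K.cellSet ν) :=
      (continuousOn_const (c := q)).congr (fun x hx => hc2 x hx.2)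
    refine (hA.union_of_isClosed hB (cw_compact K ν).isClosed (cw_skel_diff_closed K ν)).mono ?_
    intro x hx
    by_cases h : x ∈ K.cellSet ν
    · exact Or.inl (image_mono ball_subset_closedBall h)
    · exact Or.inr ⟨hx, h⟩
  · rintro _ ⟨z, hz, rfl⟩ _ ⟨w, hw, rfl⟩ h
    rw [hc1 z hz, hc1 w hw] at h
    rw [hinj hz hw h]
  · rintro _ ⟨z, hz, rfl⟩
    rw [hc1 z hz]
    exact hne z hz
  · intro t
    rcases hsurj t with h | ⟨z, hz, h⟩
    · exact Or.inl h
    · exact Or.inr ⟨K.charMap ν z, ⟨z, hz, rfl⟩, by rw [hc1 z hz, h]⟩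

open Classical in
theorem cw_p {T : Type} [TopologicalSpace T] [T2Space T] {ν σ : K.Cell}
    (hreg : K.RegularFace ν σ) (hd : K.dim ν + 1 = K.dim σ) {c : X → T} {q : T}
    (hc : ContinuousOn c (cwSkel K (K.dim ν + 1))) (hinj : InjOn c (K.cellSet ν))
    (hne : ∀ x ∈ K.cellSet ν, c x ≠ q) (hq : ∀ x, x ∉ K.cellSet ν → c x = q)
    (hsurj : ∀ t, t = q ∨ ∃ x ∈ K.cellSet ν, c x = t) :
    ∃ p : T → EuclideanSpace ℝ (Fin (K.dim σ)), Continuous p ∧ (∀ t, p t ≠ 0) ∧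
      ∀ θ, ‖θ‖ = 1 → ∀ s : ℝ, 0 ≤ s → p (c (K.charMap σ θ)) + s • θ ≠ 0 := by
  have h0 : K.charMap ν 0 ∈ K.cellSet ν := ⟨0, by simp, rfl⟩
  obtain ⟨v, hv, hv2⟩ := cw_face_mem K hreg.1 h0
  have hφ : ContinuousOn (K.charMap σ) (sphere 0 1) :=
    (K.charMap_continuousOn σ).mono sphere_subset_closedBall
  have hsk : ∀ y ∈ sphere (0 : EuclideanSpace ℝ (Fin (K.dim σ))) 1,
      K.charMap σ y ∈ cwSkel K (K.dim ν + 1) := by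
    intro y hy
    rw [hd]
    exact cw_sphere_skel K σ ⟨y, hy, rfl⟩
  have hcl : IsClosed (sphere (0 : EuclideanSpace ℝ (Fin (K.dim σ))) 1 ∩
      K.charMap σ ⁻¹' (cwSkel K (K.dim ν + 1) \ K.cellSet ν)) :=
    hφ.preimage_isClosed_of_isClosed isClosed_sphere (cw_skel_diff_closed K ν)
  obtain ⟨m, hm0, hm1, hm⟩ := exists_continuous_zero_one_of_isClosed
    (isClosed_singleton (x := v)) hcl (by
      rw [Set.disjoint_singleton_left]
      rintro ⟨-, h⟩
      apply h.2
      rw [hv2]; exact h0)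
  have hmv : m v = 0 := hm0 rfl
  have hvn : ‖v‖ = 1 := by simpa using hv
  let ψ : EuclideanSpace ℝ (Fin (K.dim σ)) → EuclideanSpace ℝ (Fin (K.dim σ)) :=
    fun y => (1 - m y) • y - m y • v
  have hψc : Continuous ψ := by
    have := m.continuous
    fun_prop
  have hψ : ∀ y, ‖y‖ = 1 → ∀ s : ℝ, 0 ≤ s → ψ y + s • y ≠ 0 := by
    intro y hy s hs h
    have h1 : (1 - m y + s) • y = m y • v := by
      have h2 : ψ y + s • y = (1 - m y + s) • y - m y • v := by
        simp only [ψ]; module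
      rw [h2] at h
      exact sub_eq_zero.1 h
    have hmy := hm y
    have h2 : 1 - m y + s = m y := by
      have h3 := congrArg norm h1
      rw [norm_smul, norm_smul, hy, hvn, Real.norm_eq_abs, Real.norm_eq_abs,
        abs_of_nonneg (by linarith [hmy.2]), abs_of_nonneg hmy.1] at h3
      linarith
    rw [h2] at h1
    have h3 : m y ≠ 0 := by
      intro h3
      rw [h3] at h2; linarith
    have h4 : y = v := smul_right_injective _ h3 h1
    rw [h4] at h3
    exact h3 hmv
  let p : T → EuclideanSpace ℝ (Fin (K.dim σ)) := fun t =>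
    if h : ∃ y ∈ sphere (0 : EuclideanSpace ℝ (Fin (K.dim σ))) 1,
      K.charMap σ y ∈ K.cellSet ν ∧ c (K.charMap σ y) = t then ψ h.choose else -v
  have hp : ∀ θ ∈ sphere (0 : EuclideanSpace ℝ (Fin (K.dim σ))) 1,
      p (c (K.charMap σ θ)) = ψ θ := by
    intro θ hθ
    by_cases hm2 : K.charMap σ θ ∈ K.cellSet ν
    · have h : ∃ y ∈ sphere (0 : EuclideanSpace ℝ (Fin (K.dim σ))) 1,
        K.charMap σ y ∈ K.cellSet ν ∧ c (K.charMap σ y) = c (K.charMap σ θ) := ⟨θ, hθ, hm2, rfl⟩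
      simp only [p, dif_pos h]
      obtain ⟨ha, hb, hcc⟩ := h.choose_spec
      congr 1
      exact cw_inj K hreg ⟨sphere_subset_closedBall ha, hb⟩ ⟨sphere_subset_closedBall hθ, hm2⟩
        (hinj hb hm2 hcc)
    · have h : ¬ ∃ y ∈ sphere (0 : EuclideanSpace ℝ (Fin (K.dim σ))) 1,
          K.charMap σ y ∈ K.cellSet ν ∧ c (K.charMap σ y) = c (K.charMap σ θ) := by
        rintro ⟨y, -, hy, hy2⟩
        rw [hq _ hm2] at hy2
        exact hne _ hy hy2
      simp only [p, dif_neg h, ψ]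
      have : m θ = 1 := hm1 ⟨hθ, hsk θ hθ, hm2⟩
      rw [this]; simp
  refine ⟨p, ?_, ?_, ?_⟩
  · have hg : ContinuousOn (fun y => c (K.charMap σ y)) (sphere 0 1) :=
      hc.comp hφ (fun y hy => hsk y hy)
    have hA : ContinuousOn p ((fun y => c (K.charMap σ y)) '' sphere 0 1) := by
      refine tp_quot (isCompact_sphere _ _) hg subset_rfl ?_
      exact hψc.continuousOn.congr (fun y hy => hp y hy.1)
    have hB : ContinuousOn p {q} := continuousOn_singleton _ _
    have hU := hA.union_of_isClosed hB
      ((isCompact_sphere _ _).image_of_continuousOn hg).isClosed isClosed_singleton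
    rw [← continuousOn_univ]
    refine hU.mono ?_
    intro t _
    rcases hsurj t with h | ⟨x, hx, h⟩
    · exact Or.inr h
    · obtain ⟨y, hy, rfl⟩ := cw_face_mem K hreg.1 hx
      exact Or.inl ⟨y, hy, h⟩
  · intro t
    by_cases h : ∃ y ∈ sphere (0 : EuclideanSpace ℝ (Fin (K.dim σ))) 1,
      K.charMap σ y ∈ K.cellSet ν ∧ c (K.charMap σ y) = t
    · simp only [p, dif_pos h]
      have h1 : ‖h.choose‖ = 1 := by simpa using h.choose_spec.1
      have := hψ _ h1 0 le_rfl
      simpa using this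
    · simp only [p, dif_neg h]
      rw [neg_ne_zero]
      intro h2
      rw [h2] at hvn; simp at hvn
  · intro θ hθ s hs
    rw [hp θ (by simpa using hθ)]
    exact hψ θ hθ s hs

theorem cw_key {ν σ τ : K.Cell} (h1 : K.RegularFace ν σ) (hd1 : K.dim ν + 1 = K.dim σ)
    (h2 : K.RegularFace σ τ) (hd2 : K.dim σ + 1 = K.dim τ) :
    ∃ σ', σ' ≠ σ ∧ K.Facet ν σ' ∧ K.Facet σ' τ := by
  by_contra hcon
  push Not at hcon
  obtain ⟨c, q, hc, hinj, hne, hq, hsurj⟩ := cw_collapse K ν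
  obtain ⟨p, hp, hp0, hps⟩ := cw_p K h1 hd1 hc hinj hne hq hsurj
  let M : Set X := K.charMap τ '' sphere 0 1
  let b : X := K.charMap σ 0
  have hbσ : b ∈ K.cellSet σ := ⟨0, by simp, rfl⟩
  obtain ⟨a, ha, hab⟩ := cw_face_mem K h2.1 hbσ
  have hauniq : ∀ y ∈ sphere (0 : EuclideanSpace ℝ (Fin (K.dim τ))) 1,
      K.charMap τ y = b → y = a := by
    intro y hy hyb
    refine cw_inj K h2 ⟨sphere_subset_closedBall hy, ?_⟩ ⟨sphere_subset_closedBall ha, ?_⟩ ?_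
    · rw [mem_preimage, hyb]; exact hbσ
    · rw [mem_preimage, hab]; exact hbσ
    · rw [hyb, hab]
  have hcs : ∀ σ', K.dim σ' = K.dim σ →
      ContinuousOn (fun z => c (K.charMap σ' z)) (sphere 0 1) := by
    intro σ' hd
    refine hc.comp ((K.charMap_continuousOn σ').mono sphere_subset_closedBall) ?_
    intro z hz
    rw [hd1, ← hd]
    exact cw_sphere_skel K σ' ⟨z, hz, rfl⟩
  -- a cell with a point outside `M \ {b}` can be retracted to its boundary
  have hretr : ∀ σ', K.dim σ' = K.dim σ → ∀ z₀ ∈ ball (0 : EuclideanSpace ℝ (Fin (K.dim σ'))) 1,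
      K.charMap σ' z₀ ∉ M \ {b} →
      ∃ e : EuclideanSpace ℝ (Fin (K.dim σ')) → sphere (0 : EuclideanSpace ℝ (Fin (K.dim ν + 1))) 1,
        ContinuousOn e (closedBall 0 1 ∩ K.charMap σ' ⁻¹' (M \ {b})) ∧
        ∀ z ∈ sphere (0 : EuclideanSpace ℝ (Fin (K.dim σ'))) 1, ∀ s : ℝ, 0 < s →
          e (z₀ + s • (z - z₀)) = c (K.charMap σ' z) := by
    intro σ' hd z₀ hz₀ hM
    obtain ⟨r, hr, hr1, hr2⟩ := tp_retr z₀ (by simpa using hz₀)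
    refine ⟨fun z => c (K.charMap σ' (r z)), ?_, ?_⟩
    · have h3 : ContinuousOn (fun z => c (K.charMap σ' (r z))) {z₀}ᶜ :=
        (hcs σ' hd).comp hr (fun z hz => by simpa using hr1 z hz)
      refine h3.mono ?_
      rintro z ⟨-, hz⟩ rfl
      exact hM hz
    · intro z hz s hs
      simp only
      rw [hr2 z (by simpa using hz) s hs]
  have hex : ∀ σ', K.dim σ' = K.dim σ →
      ∃ e : EuclideanSpace ℝ (Fin (K.dim σ')) → sphere (0 : EuclideanSpace ℝ (Fin (K.dim ν + 1))) 1,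
        ContinuousOn e (closedBall 0 1 ∩ K.charMap σ' ⁻¹' (M \ {b})) ∧
        (∀ z ∈ sphere (0 : EuclideanSpace ℝ (Fin (K.dim σ'))) 1, e z = c (K.charMap σ' z)) ∧
        (∀ z ∈ sphere (0 : EuclideanSpace ℝ (Fin (K.dim σ'))) 1, σ' = σ →
          e ((1 / 2 : ℝ) • z) = c (K.charMap σ' z)) := by
    intro σ' hd
    by_cases hσ : σ' = σ
    · subst hσ
      obtain ⟨e, he, he2⟩ := hretr σ' hd 0 (by simp) (fun h => h.2 rfl)
      refine ⟨e, he, ?_, ?_⟩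
      · intro z hz
        simpa using he2 z hz 1 one_pos
      · intro z hz _
        simpa using he2 z hz (1 / 2) (by norm_num)
    · by_cases hsub : K.cellSet σ' ⊆ M
      · have hface : K.Facet σ' τ := by
          refine ⟨fun x hx => ⟨?_, ?_⟩, by omega⟩
          · change x ∈ closure (K.charMap τ '' ball 0 1)
            rw [K.closure_cell]
            exact image_mono sphere_subset_closedBall (hsub hx)
          · intro hx2
            have := cw_uniq K hx hx2
            subst this
            omega
        have hnf : ¬ K.Face ν σ' := fun h => hcon σ' hσ ⟨h, by omega⟩ hface
        have : ∃ y ∈ K.cellSet ν, y ∉ closure (K.cellSet σ') := by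
          by_contra hno
          push Not at hno
          apply hnf
          intro y hy
          refine ⟨hno y hy, fun hy2 => ?_⟩
          have := cw_uniq K hy hy2
          subst this
          omega
        obtain ⟨y, hy, hy2⟩ := this
        obtain ⟨e, he, -, he2⟩ := tp_ext (c y) (isClosed_sphere (x := 0) (ε := 1))
          (fun z => c (K.charMap σ' z)) (hcs σ' hd) (by
            intro z hz heq
            by_cases hzν : K.charMap σ' z ∈ K.cellSet ν
            · have h3 := hinj hzν hy heq
              apply hy2
              change y ∈ closure (K.charMap σ' '' ball 0 1)
              rw [K.closure_cell]
              exact ⟨z, sphere_subset_closedBall hz, h3⟩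
            · simp only [hq _ hzν] at heq
              exact hne y hy heq.symm)
        exact ⟨e, he.continuousOn, he2, fun z _ h => absurd h hσ⟩
      · obtain ⟨x, ⟨z₀, hz₀, rfl⟩, hxM⟩ := not_subset.1 hsub
        obtain ⟨e, he, he2⟩ := hretr σ' hd z₀ hz₀ (fun h => hxM h.1)
        refine ⟨e, he, ?_, fun z _ h => absurd h hσ⟩
        intro z hz
        simpa using he2 z hz 1 one_pos
  choose e he1 he2 he3 using hex
  have hhex : ∀ x : X, ∃ t : sphere (0 : EuclideanSpace ℝ (Fin (K.dim ν + 1))) 1,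
      (∀ σ' (hd : K.dim σ' = K.dim σ), ∀ z ∈ ball (0 : EuclideanSpace ℝ (Fin (K.dim σ'))) 1,
        K.charMap σ' z = x → t = e σ' hd z) ∧
      ((∀ σ', K.dim σ' = K.dim σ → x ∉ K.cellSet σ') → t = c x) := by
    intro x
    by_cases hx : ∃ σ', K.dim σ' = K.dim σ ∧ x ∈ K.cellSet σ'
    · obtain ⟨σ', hd, z, hz, rfl⟩ := hx
      refine ⟨e σ' hd z, ?_, fun h => absurd ⟨z, hz, rfl⟩ (h σ' hd)⟩
      intro σ'' hd'' w hw hwz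
      have := cw_uniq K (⟨w, hw, hwz⟩ : K.charMap σ' z ∈ K.cellSet σ'') ⟨z, hz, rfl⟩
      subst this
      rw [K.charMap_injOn _ hw hz hwz]
    · refine ⟨c x, ?_, fun _ => rfl⟩
      intro σ' hd z hz hzx
      exact absurd ⟨σ', hd, z, hz, hzx⟩ hx
  choose h hh1 hh2 using hhex
  have hskh : ∀ x ∈ cwSkel K (K.dim σ), h x = c x := by
    intro x hx
    apply hh2
    intro σ' hd hxσ
    rw [cw_mem_skel K hxσ] at hx
    omega
  have hh3 : ∀ σ' (hd : K.dim σ' = K.dim σ),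
      ∀ z ∈ closedBall (0 : EuclideanSpace ℝ (Fin (K.dim σ'))) 1,
      h (K.charMap σ' z) = e σ' hd z := by
    intro σ' hd z hz
    rcases cw_mem_or K hz with hb | hb
    · exact hh1 _ σ' hd z hb rfl
    · rw [he2 σ' hd z hb]
      apply hskh
      rw [← hd]
      exact cw_sphere_skel K σ' ⟨z, hb, rfl⟩
  have hhc : ContinuousOn h (M \ {b}) := by
    obtain ⟨I, hI, hId, hIs⟩ := K.sphere_subset τ
    have hsk : ContinuousOn h ((M \ {b}) ∩ cwSkel K (K.dim σ)) := by
      refine (hc.mono ?_).congr (fun x hx => hskh x hx.2)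
      intro x hx
      rw [hd1]; exact hx.2
    have hcell : ∀ σ', K.dim σ' = K.dim σ →
        ContinuousOn h ((M \ {b}) ∩ K.charMap σ' '' closedBall 0 1) := by
      intro σ' hd
      refine tp_quot (isCompact_closedBall _ _) (K.charMap_continuousOn σ') inter_subset_right ?_
      refine ((he1 σ' hd).mono ?_).congr (fun z hz => hh3 σ' hd z hz.1)
      rintro z ⟨hz, hz2⟩
      exact ⟨hz, hz2.1⟩
    let F : Option K.Cell → Set X := fun o => match o with
      | none => cwSkel K (K.dim σ)
      | some σ' => K.charMap σ' '' closedBall 0 1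
    let J : Set (Option K.Cell) := insert none (some '' {σ' ∈ I | K.dim σ' = K.dim σ})
    have hJ : J.Finite := ((hI.subset (sep_subset _ _)).image _).insert _
    refine tp_cover (F := F) hJ ?_ ?_ ?_
    · rintro o (rfl | ⟨σ', hσ', rfl⟩)
      · exact cw_skel_closed K _
      · exact (cw_compact K σ').isClosed
    · rintro x ⟨hx, -⟩
      obtain ⟨ρ, hρ, hxρ⟩ := mem_iUnion₂.1 (hIs hx)
      have hlt := hId ρ hρ
      by_cases hd : K.dim ρ = K.dim σ
      · exact mem_iUnion₂.2 ⟨some ρ, Or.inr ⟨ρ, ⟨hρ, hd⟩, rfl⟩, image_mono ball_subset_closedBall hxρ⟩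
      · exact mem_iUnion₂.2 ⟨none, Or.inl rfl, (cw_mem_skel K hxρ).2 (by omega)⟩
    · rintro o (rfl | ⟨σ', hσ', rfl⟩)
      · exact hsk
      · exact hcell σ' hσ'.2
  -- the small sphere around the preimage of the centre of `σ`
  have hhalf : ∀ θ ∈ sphere (0 : EuclideanSpace ℝ (Fin (K.dim σ))) 1,
      (1 / 2 : ℝ) • θ ∈ ball (0 : EuclideanSpace ℝ (Fin (K.dim σ))) 1 := by
    intro θ hθ
    have : ‖θ‖ = 1 := by simpa using hθ
    rw [mem_ball_zero_iff, norm_smul, this]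
    norm_num
  have hβex : ∀ θ : EuclideanSpace ℝ (Fin (K.dim σ)),
      ∃ y : sphere (0 : EuclideanSpace ℝ (Fin (K.dim τ))) 1,
        θ ∈ sphere (0 : EuclideanSpace ℝ (Fin (K.dim σ))) 1 →
          K.charMap τ y = K.charMap σ ((1 / 2 : ℝ) • θ) := by
    intro θ
    by_cases hθ : θ ∈ sphere (0 : EuclideanSpace ℝ (Fin (K.dim σ))) 1
    · obtain ⟨y, hy, hy2⟩ := cw_face_mem K h2.1
        (⟨_, hhalf θ hθ, rfl⟩ : K.charMap σ ((1 / 2 : ℝ) • θ) ∈ K.cellSet σ)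
      exact ⟨⟨y, hy⟩, fun _ => hy2⟩
    · exact ⟨⟨a, ha⟩, fun h => absurd h hθ⟩
  choose β hβ using hβex
  have hβc : ContinuousOn β (sphere 0 1) := by
    obtain ⟨-, ⟨ee, hee⟩, -⟩ := id h2
    rw [continuousOn_iff_continuous_domRestrict, Topology.IsInducing.subtypeVal.continuous_iff]
    have hmem : ∀ θ : sphere (0 : EuclideanSpace ℝ (Fin (K.dim σ))) 1,
        K.charMap σ ((1 / 2 : ℝ) • (θ : EuclideanSpace ℝ (Fin (K.dim σ)))) ∈ K.cellSet σ :=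
      fun θ => ⟨_, hhalf θ θ.2, rfl⟩
    have hcont : Continuous (fun θ : sphere (0 : EuclideanSpace ℝ (Fin (K.dim σ))) 1 =>
        (⟨_, hmem θ⟩ : K.cellSet σ)) := by
      refine Continuous.subtype_mk ?_ _
      refine (K.charMap_continuousOn σ).comp_continuous (by fun_prop) ?_
      intro θ
      exact ball_subset_closedBall (hhalf θ θ.2)
    have h3 := continuous_subtype_val.comp (ee.symm.continuous.comp hcont)
    refine h3.congr ?_
    intro θ
    have h4 := hβ θ θ.2
    have h5 : (β θ : EuclideanSpace ℝ (Fin (K.dim τ))) ∈ K.preim σ τ :=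
      ⟨sphere_subset_closedBall (β θ).2, by rw [mem_preimage, h4]; exact hmem θ⟩
    have h6 : ee ⟨_, h5⟩ = ⟨_, hmem θ⟩ := by
      apply Subtype.ext
      rw [hee]; exact h4
    simp only [Function.comp_apply, ← h6, Homeomorph.symm_apply_apply]
    rfl
  obtain ⟨β', hβ', hβa, hββ⟩ := tp_ext (⟨a, ha⟩ : sphere (0 : EuclideanSpace ℝ (Fin (K.dim τ))) 1)
    (isClosed_sphere (x := 0) (ε := 1)) β hβc (by
      intro θ hθ heq
      have h3 := hβ θ hθ
      rw [heq] at h3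
      have h4 : K.charMap σ 0 = K.charMap σ ((1 / 2 : ℝ) • θ) := hab.symm.trans h3
      have h5 := K.charMap_injOn σ (by simp) (hhalf θ hθ) h4
      have h6 : ‖θ‖ = 1 := by simpa using hθ
      have h7 : θ = 0 := by
        rcases smul_eq_zero.1 h5.symm with h | h
        · norm_num at h
        · exact h
      rw [h7] at h6; simp at h6)
  have hMb : ∀ x, K.charMap τ (β' x) ∈ M \ {b} := by
    intro x
    refine ⟨⟨_, (β' x).2, rfl⟩, fun hx => hβa x ?_⟩
    exact Subtype.ext (hauniq _ (β' x).2 hx)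
  refine bw_boundary (fun x => p (h (K.charMap τ (β' x)))) ?_ (fun x _ => hp0 _) ?_
  · apply Continuous.continuousOn
    refine hp.comp (hhc.comp_continuous ?_ hMb)
    refine (K.charMap_continuousOn τ).comp_continuous (continuous_subtype_val.comp hβ') ?_
    intro x
    exact sphere_subset_closedBall (β' x).2
  · intro θ hθ s hs
    have hθ' : θ ∈ sphere (0 : EuclideanSpace ℝ (Fin (K.dim σ))) 1 := by simpa using hθ
    rw [hββ θ hθ', hβ θ hθ', hh3 σ rfl _ (ball_subset_closedBall (hhalf θ hθ')),
      he3 σ rfl θ hθ' rfl]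
    exact hps θ hθ s hs

theorem mb_adj_symm {σ τ : K.Cell} (h : K.Adjacent σ τ) : K.Adjacent τ σ := h.symm

theorem mb_path_symm {f : K.Cell → ℝ} {r : ℝ} {σ τ : K.Cell} (h : K.RPath f r σ τ) :
    K.RPath f r τ σ := by
  obtain ⟨h1, h2⟩ := h
  induction h2 with
  | refl => exact ⟨h1, .refl⟩
  | tail _ hb ih => exact ⟨hb.2, .head ⟨hb.1.symm, ih.1⟩ ih.2⟩

theorem mb_path_trans {f : K.Cell → ℝ} {r : ℝ} {σ τ ρ : K.Cell} (h : K.RPath f r σ τ)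
    (h' : K.RPath f r τ ρ) : K.RPath f r σ ρ := ⟨h.1, h.2.trans h'.2⟩

theorem mb_coll (f : K.Cell → ℝ) (τ : K.Cell) :
    K.IsCollection f {x | K.RPath f (f τ) τ x} := by
  refine ⟨⟨f τ, fun σ hσ => (mb_path_symm K hσ).1, fun σ hσ ρ hρ =>
    mb_path_trans K (mb_path_symm K hσ) hρ⟩, ?_⟩
  rintro C' hsub ⟨c, hc, hp⟩
  refine Subset.antisymm ?_ hsub
  intro x hx
  have hτ : τ ∈ C' := hsub ⟨rfl, .refl⟩
  have := hp τ hτ x hx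
  rw [← hc τ hτ] at this
  exact this

end CWHelp

/-- Lemma `lemupnon`: for a discrete Morse–Bott function `f`, a
collection `C ∈ 𝒞_f`, and an upward noncritical cell `σ ∈ C`, every cell `ν ∈ C` with
`ν ≺ σ` is upward noncritical. -/
theorem facet_upward_noncritical {X : Type} [TopologicalSpace X] [T2Space X]
    (K : CWComplexCells X) (f : K.Cell → ℝ) (hf : K.DiscreteMorseBott f)
    (C : Set K.Cell) (hC : K.IsCollection f C) (σ : K.Cell) (hσ : σ ∈ C)
    (hup : K.UC f C σ = 1) (ν : K.Cell) (hν : ν ∈ C) (hνσ : K.Facet ν σ) :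
    K.UC f C ν = 1 := by
  obtain ⟨⟨c, hCc, hCp⟩, hmax⟩ := id hC
  obtain ⟨hI, hU, -, -⟩ := hf C hC σ hσ
  obtain ⟨hIν, hUν, -, -⟩ := hf C hC ν hν
  obtain ⟨τ, hτ⟩ := Set.encard_eq_one.1 hup
  have hτm : τ ∈ K.UCset f C σ := by rw [hτ]; rfl
  obtain ⟨hτC, hστ, hfτ⟩ := hτm
  have hlt : f τ < f σ := by
    refine lt_of_le_of_ne hfτ fun heq => hτC ?_
    have hτc : f τ = c := heq.trans (hCc σ hσ)
    have hst : K.RPath f c σ τ := ⟨hCc σ hσ, .single ⟨Or.inl hστ, hτc⟩⟩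
    have hpre : K.IsPreCollection f (insert τ C) := by
      have key : ∀ x ∈ insert τ C, K.RPath f c σ x := by
        rintro x (rfl | hx)
        · exact hst
        · exact hCp σ hσ x hx
      exact ⟨c, fun x hx => (mb_path_symm K (key x hx)).1, fun x hx y hy =>
        mb_path_trans K (mb_path_symm K (key x hx)) (key y hy)⟩
    rw [← hmax _ (subset_insert τ C) hpre]
    exact mem_insert τ C
  have hr2 : K.RegularFace σ τ := by
    by_contra h
    have := hI τ ⟨hστ.1, h⟩
    linarith
  have hr1 : K.RegularFace ν σ := by
    by_contra h
    have := hIν σ ⟨hνσ.1, h⟩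
    rw [hCc ν hν, hCc σ hσ] at this
    exact lt_irrefl _ this
  obtain ⟨σ', hne, hνσ', hσ'τ⟩ := cw_key K hr1 hνσ.2 hr2 hστ.2
  obtain ⟨-, -, -, hD⟩ := hf _ (mb_coll K f τ) τ ⟨rfl, .refl⟩
  have hmem : ∀ ρ, K.Facet ρ τ → f τ < f ρ →
      ρ ∈ K.DCset f {x | K.RPath f (f τ) τ x} τ := by
    intro ρ hρ hl
    refine ⟨fun h => ?_, hρ, hl.le⟩
    have := (mb_path_symm K h).1
    linarith
  have hle : f σ' ≤ f τ := by
    by_contra! h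
    exact hne (Set.encard_le_one_iff.1 hD _ _ (hmem σ' hσ'τ h) (hmem σ hστ hlt))
  have hfν : f ν = f σ := (hCc ν hν).trans (hCc σ hσ).symm
  refine le_antisymm hUν (Set.one_le_encard_iff_nonempty.2 ⟨σ', ?_, hνσ', by linarith⟩)
  intro h
  have := hCc σ' h
  rw [← hCc σ hσ] at this
  linarith
end

section
/- Let f : K → ℝ be a discrete Morse–Bott function on a CW complex K and C ∈ 𝒞_f a collection. For every cell σ ∈ C \ C^red, exactly one of the following two statements holds: (1) σ is upward noncritical; (2) σ is downward noncritical. -/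
/-!
Set-based CW complexes: a CW complex is identified with the family of its cells.
Each `n`-cell `τ` has a characteristic map `charMap τ : D^n → X` (from the closed
unit disk of `EuclideanSpace ℝ (Fin n)`), the open cells partition `X`, the closure
of each cell is the image of the closed disk, the boundary sphere is mapped into
finitely many cells of strictly lower dimension (closure finiteness), and `X`
carries the weak topology determined by the closed cells.
-/

open Metric Set

section Brouwer
open MeasureTheory Metric Set

theorem bw_det_poly_s9 {E : Type*} [NormedAddCommGroup E] [InnerProductSpace ℝ E]
    [FiniteDimensional ℝ E] (A : E →L[ℝ] E) :
    ∃ p : Polynomial ℝ, p.natDegree ≤ Module.finrank ℝ E ∧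
      ∀ t : ℝ, p.eval t = (ContinuousLinearMap.id ℝ E + t • A).det := by
  classical
  let b := Module.finBasis ℝ E
  let M := LinearMap.toMatrix b b (A : E →ₗ[ℝ] E)
  refine ⟨((Polynomial.X : Polynomial ℝ) • M.map Polynomial.C
    + (1 : Matrix _ _ ℝ).map Polynomial.C).det, ?_, ?_⟩
  · simpa using Polynomial.natDegree_det_X_add_C_le M 1
  · intro t
    rw [← Polynomial.coe_evalRingHom, RingHom.map_det]
    change _ = LinearMap.det _
    rw [← LinearMap.det_toMatrix b]
    congr 1
    have : ((ContinuousLinearMap.id ℝ E + t • A : E →L[ℝ] E) : E →ₗ[ℝ] E)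
      = LinearMap.id + t • (A : E →ₗ[ℝ] E) := rfl
    have e : LinearMap.toMatrix b b (LinearMap.id + t • (A : E →ₗ[ℝ] E)) = 1 + t • M := by
      rw [map_add, map_smul, LinearMap.toMatrix_id]
    rw [this, e]
    ext i j
    have h1 : ((Polynomial.evalRingHom t) ((1 : Matrix _ _ ℝ).map Polynomial.C i j))
        = (1 : Matrix _ _ ℝ) i j := by
      simp [Matrix.map_apply]
    have h2 : ((Polynomial.evalRingHom t)
        (((Polynomial.X : Polynomial ℝ) • M.map Polynomial.C) i j)) = t * M i j := by
      simp [Matrix.map_apply, Matrix.smul_apply]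
      exact mul_comm _ _
    rw [RingHom.mapMatrix_apply, Matrix.map_apply, Matrix.add_apply, map_add, h1, h2,
      Matrix.add_apply, Matrix.smul_apply, smul_eq_mul, add_comm]

theorem bw_det_interp {E : Type*} [NormedAddCommGroup E] [InnerProductSpace ℝ E]
    [FiniteDimensional ℝ E] (A : E →L[ℝ] E) (v : ℕ → ℝ) (hv : Function.Injective v) (t : ℝ) :
    (ContinuousLinearMap.id ℝ E + t • A).det =
      ∑ i ∈ Finset.range (Module.finrank ℝ E + 1),
        (Lagrange.basis (Finset.range (Module.finrank ℝ E + 1)) v i).eval t *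
          (ContinuousLinearMap.id ℝ E + v i • A).det := by
  obtain ⟨p, hp, hpe⟩ := bw_det_poly_s9 A
  have := Lagrange.eq_interpolate (s := Finset.range (Module.finrank ℝ E + 1)) (v := v) (f := p)
    hv.injOn (by
      rw [Finset.card_range]
      exact lt_of_le_of_lt Polynomial.degree_le_natDegree (by exact_mod_cast Nat.lt_succ_of_le hp))
  rw [← hpe t]
  conv_lhs => rw [this]
  rw [Lagrange.interpolate_apply, Polynomial.eval_finsetSum]
  refine Finset.sum_congr rfl fun i _ => ?_
  simp [hpe, mul_comm]

theorem bw_vol {E : Type*} [NormedAddCommGroup E] [InnerProductSpace ℝ E]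
    [FiniteDimensional ℝ E] [MeasurableSpace E] [BorelSpace E]
    (f : E → E) (hf : ContDiff ℝ 1 f) (h1 : ∀ x, ‖f x‖ = 1) (h2 : ∀ x, ‖x‖ = 1 → f x = x) :
    ∃ δ > (0 : ℝ), ∀ t : ℝ, 0 < t → t < δ →
      ∫ x in ball (0 : E) 1, (ContinuousLinearMap.id ℝ E + t • (fderiv ℝ f x - ContinuousLinearMap.id ℝ E)).det
        = ∫ _ in ball (0 : E) 1, (1 : ℝ) := by
  have hfd : Differentiable ℝ f := hf.differentiable (by norm_num)
  have hc : Continuous (fun x => fderiv ℝ f x - ContinuousLinearMap.id ℝ E) :=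
    (hf.continuous_fderiv (by norm_num)).sub continuous_const
  obtain ⟨C, hC⟩ := (isCompact_closedBall (0 : E) 1).exists_bound_of_continuousOn hc.continuousOn
  have hC0 : 0 ≤ C := (norm_nonneg _).trans (hC 0 (by simp))
  refine ⟨1 / (C + 1), by positivity, fun t ht0 ht => ?_⟩
  have htC : t * C < 1 := by
    rw [lt_div_iff₀ (by positivity)] at ht
    nlinarith
  have ht1 : t < 1 := lt_of_lt_of_le ht (by rw [div_le_one (by positivity)]; linarith)
  set F : E → E := fun x => x + t • (f x - x) with hF
  have hFd : ∀ x, HasStrictFDerivAt F (ContinuousLinearMap.id ℝ E + t • (fderiv ℝ f x - ContinuousLinearMap.id ℝ E)) x := by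
    intro x
    have h := hf.hasStrictFDerivAt (x := x) (by norm_num)
    exact (hasStrictFDerivAt_id x).add ((h.sub (hasStrictFDerivAt_id x)).const_smul t)
  have hgl : ∀ x ∈ closedBall (0 : E) 1, ∀ y ∈ closedBall (0 : E) 1,
      ‖(f y - y) - (f x - x)‖ ≤ C * ‖y - x‖ := by
    intro x hx y hy
    refine Convex.norm_image_sub_le_of_norm_hasFDerivWithin_le (𝕜 := ℝ) (f := fun x => f x - x)
      (f' := fun x => fderiv ℝ f x - ContinuousLinearMap.id ℝ E)
      (fun z _ => (((hfd z).hasFDerivAt).sub (hasFDerivAt_id z)).hasFDerivWithinAt)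
      hC (convex_closedBall _ _) hx hy
  have hinj : InjOn F (closedBall 0 1) := by
    intro x hx y hy hxy
    have h := hgl x hx y hy
    have e : y - x = - (t • ((f y - y) - (f x - x))) := by
      simp only [hF] at hxy
      have : y - x + t • ((f y - y) - (f x - x)) = 0 := by
        rw [smul_sub]
        have := sub_eq_zero.2 hxy.symm
        rw [← this]; abel
      exact eq_neg_of_add_eq_zero_left this
    have e2 : ‖y - x‖ = t * ‖(f y - y) - (f x - x)‖ := by
      conv_lhs => rw [e]
      rw [norm_neg, norm_smul, Real.norm_of_nonneg ht0.le]
    have : ‖y - x‖ ≤ t * C * ‖y - x‖ := by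
      conv_lhs => rw [e2]
      rw [mul_assoc]; gcongr
    have h0 : ‖y - x‖ = 0 := by
      by_contra h0
      have : 0 < ‖y - x‖ := lt_of_le_of_ne (norm_nonneg _) (Ne.symm h0)
      nlinarith
    exact (sub_eq_zero.1 (norm_eq_zero.1 h0)).symm
  have hinjA : ∀ x ∈ closedBall (0 : E) 1, ∀ s ∈ Icc (0:ℝ) t,
      (ContinuousLinearMap.id ℝ E + s • (fderiv ℝ f x - ContinuousLinearMap.id ℝ E)).det ≠ 0 := by
    intro x hx s hs h0
    obtain ⟨v, hv, hv0⟩ := (Submodule.ne_bot_iff _).1 (LinearMap.bot_lt_ker_of_det_eq_zero h0).ne'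
    have e : v = - (s • ((fderiv ℝ f x - ContinuousLinearMap.id ℝ E) v)) := by
      have : v + s • ((fderiv ℝ f x - ContinuousLinearMap.id ℝ E) v) = 0 := hv
      exact eq_neg_of_add_eq_zero_left this
    have hvp : 0 < ‖v‖ := norm_pos_iff.2 hv0
    have e2 : ‖v‖ ≤ s * (C * ‖v‖) := by
      conv_lhs => rw [e]
      rw [norm_neg, norm_smul, Real.norm_of_nonneg hs.1]
      have := hs.1
      gcongr
      exact (ContinuousLinearMap.le_opNorm _ _).trans (by gcongr; exact hC x hx)
    have : s * C ≤ t * C := by have := hs.2; gcongr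
    nlinarith
  have hpos : ∀ x ∈ closedBall (0 : E) 1,
      0 < (ContinuousLinearMap.id ℝ E + t • (fderiv ℝ f x - ContinuousLinearMap.id ℝ E)).det := by
    intro x hx
    by_contra hneg
    push Not at hneg
    have hcont : ContinuousOn (fun s : ℝ => (ContinuousLinearMap.id ℝ E + s • (fderiv ℝ f x - ContinuousLinearMap.id ℝ E)).det) (Icc 0 t) := by
      apply Continuous.continuousOn
      exact ContinuousLinearMap.continuous_det.comp (by fun_prop)
    have := intermediate_value_Icc' ht0.le hcont
    obtain ⟨s, hs, hs0⟩ := this ⟨hneg, by simp [ContinuousLinearMap.det]⟩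
    exact hinjA x hx s hs hs0
  have hFc : Continuous F := by have := hf.continuous; fun_prop
  have hmaps : MapsTo F (ball 0 1) (ball 0 1) := by
    intro x hx
    rw [mem_ball_zero_iff] at hx ⊢
    have : F x = (1 - t) • x + t • f x := by simp only [hF]; module
    rw [this]
    refine (norm_add_le _ _).trans_lt ?_
    rw [norm_smul, norm_smul, h1, Real.norm_of_nonneg ht0.le, Real.norm_of_nonneg (by linarith)]
    nlinarith
  have himg : F '' ball 0 1 = ball 0 1 := by
    refine hmaps.image_subset.antisymm ?_
    refine (convex_ball (0 : E) 1).isPreconnected.subset_of_closure_inter_subset ?_ ?_ ?_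
    · rw [isOpen_iff_mem_nhds]
      rintro _ ⟨x, hx, rfl⟩
      have hd := (hpos x (ball_subset_closedBall hx)).ne'
      have hs := (hFd x).map_nhds_eq_of_surj (by
        rw [LinearMap.range_eq_top]
        exact (LinearMap.equivOfDetNeZero _ hd).surjective)
      rw [← hs]
      exact Filter.image_mem_map (isOpen_ball.mem_nhds hx)
    · exact ⟨F 0, hmaps (by simp), mem_image_of_mem _ (by simp)⟩
    · rintro y ⟨hy, hy1⟩
      have hcl : closure (F '' ball 0 1) ⊆ F '' closedBall 0 1 :=
        closure_minimal (image_mono ball_subset_closedBall)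
          ((isCompact_closedBall _ _).image hFc).isClosed
      obtain ⟨x, hx, rfl⟩ := hcl hy
      refine mem_image_of_mem _ ?_
      rw [mem_closedBall_zero_iff] at hx
      rw [mem_ball_zero_iff] at hy1 ⊢
      refine lt_of_le_of_ne hx fun h => ?_
      have : F x = x := by simp [hF, h2 x h]
      rw [this] at hy1; linarith
  have key := integral_image_eq_integral_abs_det_fderiv_smul (volume : Measure E) (F := ℝ)
    (measurableSet_ball (x := (0:E)) (ε := 1))
    (fun x _ => (hFd x).hasFDerivAt.hasFDerivWithinAt) (hinj.mono ball_subset_closedBall) (fun _ => 1)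
  rw [himg] at key
  rw [key]
  refine setIntegral_congr_fun measurableSet_ball fun x hx => ?_
  simp [abs_of_pos (hpos x (ball_subset_closedBall hx))]

theorem bw_no_smooth {E : Type*} [NormedAddCommGroup E] [InnerProductSpace ℝ E]
    [FiniteDimensional ℝ E] 
    (f : E → E) (hf : ContDiff ℝ 1 f) (h1 : ∀ x, ‖f x‖ = 1) (h2 : ∀ x, ‖x‖ = 1 → f x = x) :
    False := by
  borelize E
  obtain ⟨δ, hδ, H⟩ := bw_vol f hf h1 h2
  set n := Module.finrank ℝ E
  let v : ℕ → ℝ := fun i => δ / (i + 2)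
  have hv : Function.Injective v := by
    intro i j hij
    simp only [v] at hij
    have hi : (0:ℝ) < i + 2 := by positivity
    have hj : (0:ℝ) < j + 2 := by positivity
    rw [div_eq_div_iff hi.ne' hj.ne'] at hij
    have := mul_left_cancel₀ hδ.ne' hij
    exact_mod_cast (add_right_cancel this).symm
  have hfd : Differentiable ℝ f := hf.differentiable (by norm_num)
  have hc : Continuous (fun x => fderiv ℝ f x - ContinuousLinearMap.id ℝ E) :=
    (hf.continuous_fderiv (by norm_num)).sub continuous_const
  have hv1 : ∀ i, 0 < v i := fun i => by positivity
  have hv2 : ∀ i, v i < δ := fun i => by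
    simp only [v]
    rw [div_lt_iff₀ (by positivity)]
    have : (0:ℝ) ≤ i := by positivity
    nlinarith
  have hzero : ∀ x, (fderiv ℝ f x).det = 0 := by
    intro x
    by_contra hd
    obtain ⟨w, hw⟩ := (LinearMap.equivOfDetNeZero _ hd).surjective (f x)
    have hw : fderiv ℝ f x w = f x := hw
    have hconst : (fun y => inner ℝ (f y) (f y)) = fun _ => (1 : ℝ) := by
      ext y; rw [real_inner_self_eq_norm_sq, h1]; norm_num
    have hd1 := (hfd x).hasFDerivAt.inner ℝ (hfd x).hasFDerivAt
    rw [hconst] at hd1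
    have := congrArg (fun A => A w) (hd1.unique (hasFDerivAt_const _ _))
    simp [hw, h1] at this
  have e0 : ∫ x in ball (0 : E) 1, (ContinuousLinearMap.id ℝ E + (1:ℝ) • (fderiv ℝ f x - ContinuousLinearMap.id ℝ E)).det = 0 := by
    simp [hzero]
  have e1 : ∫ x in ball (0 : E) 1, (ContinuousLinearMap.id ℝ E + (1:ℝ) • (fderiv ℝ f x - ContinuousLinearMap.id ℝ E)).det = ∫ _ in ball (0 : E) 1, (1 : ℝ) := by
    simp_rw [fun x => bw_det_interp (fderiv ℝ f x - ContinuousLinearMap.id ℝ E) v hv 1]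
    rw [integral_finsetSum]
    · simp_rw [integral_const_mul]
      rw [Finset.sum_congr rfl fun i _ => by rw [H (v i) (hv1 i) (hv2 i)]]
      rw [← Finset.sum_mul, ← Polynomial.eval_finsetSum, Lagrange.sum_basis hv.injOn ⟨0, by simp⟩]
      simp
    · intro i _
      apply Integrable.const_mul
      refine (ContinuousOn.integrableOn_compact (isCompact_closedBall (0:E) 1) ?_).mono_set
        ball_subset_closedBall
      apply Continuous.continuousOn
      exact ContinuousLinearMap.continuous_det.comp (by fun_prop)
  rw [e0] at e1
  have hvol := measure_ball_pos (volume : Measure E) (0:E) one_pos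
  rw [setIntegral_const, smul_eq_mul, mul_one, measureReal_def, eq_comm, ENNReal.toReal_eq_zero_iff] at e1
  rcases e1 with h | h
  · exact hvol.ne' h
  · exact measure_ball_lt_top.ne h

/-- No nowhere-vanishing continuous self-map equal to the identity outside the unit ball. -/
theorem bw_no_cont {E : Type*} [NormedAddCommGroup E] [InnerProductSpace ℝ E]
    [FiniteDimensional ℝ E]
    (f : E → E) (hf : Continuous f) (h1 : ∀ x, f x ≠ 0) (h2 : ∀ x, 1 ≤ ‖x‖ → f x = x) :
    False := by
  -- lower bound for the norm of `f`
  have hb : ∃ ε > 0, ∀ x, ε ≤ ‖f x‖ := by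
    obtain ⟨x0, -, hx0⟩ := (isCompact_closedBall (0 : E) 1).exists_isMinOn ⟨0, by simp⟩
      hf.norm.continuousOn
    refine ⟨min ‖f x0‖ 1, lt_min (norm_pos_iff.2 (h1 _)) one_pos, fun x => ?_⟩
    rcases le_total ‖x‖ 1 with h | h
    · exact (min_le_left _ _).trans (hx0 (by simpa using h))
    · rw [h2 x h]; exact (min_le_right _ _).trans h
  obtain ⟨ε, hε, hb⟩ := hb
  obtain ⟨g, hg, hgd, hge, -⟩ := hf.exists_contDiff_approx_and_eqOn (n := 1)
    (ε := fun _ => ε) continuous_const (fun _ => hε)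
    (S := {x | 2 ≤ ‖x‖}) (U := {x | 1 < ‖x‖}) (isClosed_le continuous_const continuous_norm)
    ((isOpen_lt continuous_const continuous_norm).mem_nhdsSet.2 fun x hx => by
      simp only [mem_ofPred_eq] at *; linarith)
    (contDiff_id.contDiffOn.congr fun x hx => h2 x (le_of_lt hx))
  have hg0 : ∀ x, g x ≠ 0 := by
    intro x hx
    have := hgd x
    rw [hx, dist_zero_left] at this
    exact absurd (hb x) (not_le.2 this)
  refine bw_no_smooth (fun x => (‖g ((2:ℝ) • x)‖)⁻¹ • g ((2:ℝ) • x)) ?_ ?_ ?_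
  · have h : ContDiff ℝ 1 (fun x => g ((2:ℝ) • x)) := (by exact_mod_cast hg : ContDiff ℝ 1 g).comp (contDiff_const_smul 2)
    exact ((h.norm ℝ fun x => hg0 _).inv fun x => norm_ne_zero_iff.2 (hg0 _)).smul h
  · intro x
    rw [norm_smul, norm_inv, norm_norm, inv_mul_cancel₀ (norm_ne_zero_iff.2 (hg0 _))]
  · intro x hx
    have h2x : ‖(2:ℝ) • x‖ = 2 := by rw [norm_smul, hx]; norm_num
    have : g ((2:ℝ) • x) = (2:ℝ) • x := by
      rw [hge (by simp [h2x] : (2:ℝ) • x ∈ {x : E | 2 ≤ ‖x‖}), h2 _ (by rw [h2x]; norm_num)]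
    simp only [this, h2x, smul_smul]; norm_num

/-- Radial projection to the closed unit ball. -/
noncomputable def bwProj {E : Type*} [NormedAddCommGroup E] [InnerProductSpace ℝ E] (x : E) : E :=
  (max 1 ‖x‖)⁻¹ • x

theorem bwProj_continuous {E : Type*} [NormedAddCommGroup E] [InnerProductSpace ℝ E] :
    Continuous (bwProj : E → E) := by
  unfold bwProj
  have : Continuous fun x : E => (max 1 ‖x‖)⁻¹ :=
    Continuous.inv₀ (by fun_prop) fun x => (lt_of_lt_of_le one_pos (le_max_left _ _)).ne'
  fun_prop

theorem bwProj_norm {E : Type*} [NormedAddCommGroup E] [InnerProductSpace ℝ E] (x : E) :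
    ‖bwProj x‖ ≤ 1 := by
  unfold bwProj
  have : 0 < max 1 ‖x‖ := lt_of_lt_of_le one_pos (le_max_left _ _)
  rw [norm_smul, norm_inv, Real.norm_of_nonneg this.le, inv_mul_le_iff₀ this, mul_one]
  exact le_max_right _ _

theorem bwProj_eq {E : Type*} [NormedAddCommGroup E] [InnerProductSpace ℝ E] {x : E}
    (h : ‖x‖ ≤ 1) : bwProj x = x := by
  simp [bwProj, max_eq_left h]

theorem bw_main {E : Type*} [NormedAddCommGroup E] [InnerProductSpace ℝ E]
    [FiniteDimensional ℝ E]
    (M : E → E) (hM : ContinuousOn M (closedBall 0 1)) (h0 : ∀ x ∈ closedBall (0 : E) 1, M x ≠ 0)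
    (h1 : ∀ x, ‖x‖ = 1 → ∀ c : ℝ, 0 ≤ c → M x ≠ - (c • x)) : False := by
  set l : E → ℝ := fun x => max 0 (min 1 (‖x‖ - 1)) with hl
  have hlc : Continuous l := by fun_prop
  have hMp : Continuous fun x => M (bwProj x) :=
    hM.comp_continuous bwProj_continuous fun x => by simpa using bwProj_norm x
  set R : E → E := fun x => (1 - l x) • M (bwProj x) + l x • x with hR
  have hRc : Continuous R :=
    ((continuous_const.sub hlc).smul hMp).add (hlc.smul continuous_id)
  have hR0 : ∀ x, R x ≠ 0 := by
    intro x hx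
    simp only [hR] at hx
    rcases le_or_gt ‖x‖ 1 with h | h
    · have : l x = 0 := by
        simp only [hl]; apply max_eq_left; exact (min_le_right _ _).trans (by linarith)
      rw [this] at hx
      simp at hx
      exact h0 _ (by simpa using bwProj_norm x) hx
    · have hpx : bwProj x = ‖x‖⁻¹ • x := by simp [bwProj, max_eq_right h.le]
      have hxp : 0 < ‖x‖ := by linarith
      have hn : ‖bwProj x‖ = 1 := by
        rw [hpx, norm_smul, norm_inv, norm_norm, inv_mul_cancel₀ hxp.ne']
      have hx' : x = ‖x‖ • bwProj x := by rw [hpx, smul_smul, mul_inv_cancel₀ hxp.ne', one_smul]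
      have hl0 : 0 ≤ l x := le_max_left _ _
      have hl1 : l x ≤ 1 := max_le zero_le_one (min_le_left _ _)
      rcases hl1.eq_or_lt with e | e
      · rw [e] at hx
        simp at hx
        simp [hx] at hxp
      · have hd : 0 < 1 - l x := by linarith
        refine h1 _ hn ((1 - l x)⁻¹ * (l x * ‖x‖)) (by positivity) ?_
        have : (1 - l x) • M (bwProj x) = - (l x • x) := eq_neg_of_add_eq_zero_left hx
        calc M (bwProj x) = (1 - l x)⁻¹ • ((1 - l x) • M (bwProj x)) := by
              rw [smul_smul, inv_mul_cancel₀ hd.ne', one_smul]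
          _ = - (((1 - l x)⁻¹ * (l x * ‖x‖)) • bwProj x) := by
              rw [this]
              conv_lhs => rw [hx']
              rw [smul_neg, smul_smul, smul_smul, ← hx', mul_assoc]
  have hR1 : ∀ x, 2 ≤ ‖x‖ → R x = x := by
    intro x hx
    have : l x = 1 := by
      simp only [hl]; rw [min_eq_left (by linarith)]; simp
    simp [hR, this]
  refine bw_no_cont (fun x => (2:ℝ)⁻¹ • R ((2:ℝ) • x)) (by fun_prop) (fun x => ?_) fun x hx => ?_
  · simpa using hR0 _
  · rw [hR1 _ (by rw [norm_smul]; norm_num; linarith), smul_smul]; norm_num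

end Brouwer

section TopLemmas
open Metric Set

theorem tz_sphere {Y : Type*} [TopologicalSpace Y] [NormalSpace Y] {F : Type*}
    [NormedAddCommGroup F] [InnerProductSpace ℝ F] [FiniteDimensional ℝ F]
    {C : Set Y} (hC : IsClosed C) (f : Y → F) (hf : ContinuousOn f C) (q : F) (hq : ‖q‖ = 1)
    (h1 : ∀ y ∈ C, ‖f y‖ = 1) (h2 : ∀ y ∈ C, f y ≠ q) :
    ∃ g : Y → F, Continuous g ∧ (∀ y, ‖g y‖ = 1) ∧ (∀ y, g y ≠ q) ∧ ∀ y ∈ C, g y = f y := by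
  let fS : C → sphere (0 : F) 1 := fun y => ⟨f y, by simpa using h1 y y.2⟩
  have hfS : Continuous fS := (continuousOn_iff_continuous_domRestrict.1 hf).subtype_mk _
  have hsrc : ∀ y, fS y ∈ (stereographic hq).source := by
    intro y
    rw [stereographic_source]
    intro h
    exact h2 y y.2 (congrArg Subtype.val h)
  let k : C(C, (ℝ ∙ q)ᗮ) := ⟨fun y => stereographic hq (fS y),
    (stereographic hq).continuousOn.comp_continuous hfS hsrc⟩
  obtain ⟨K, hK⟩ := ContinuousMap.exists_restrict_eq hC k
  refine ⟨fun y => ((stereographic hq).symm (K y) : F), ?_, ?_, ?_, ?_⟩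
  · exact continuous_subtype_val.comp
      ((isOpenEmbedding_stereographic_symm hq).continuous.comp K.continuous)
  · intro y; simp
  · intro y h
    have : (stereographic hq).symm (K y) ∈ (stereographic hq).source :=
      (stereographic hq).map_target (by simp)
    rw [stereographic_source] at this
    exact this (Subtype.ext h)
  · intro y hy
    have : K y = stereographic hq (fS ⟨y, hy⟩) := congrArg (fun m => m ⟨y, hy⟩) hK
    change ((stereographic hq).symm (K y) : F) = f y
    rw [this, (stereographic hq).left_inv (hsrc _)]

theorem retr_sphere {E : Type*} [NormedAddCommGroup E] [InnerProductSpace ℝ E] (u0 : E)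
    (h : ‖u0‖ < 1) : ∃ r : E → E, ContinuousOn r {u0}ᶜ ∧ (∀ u, u ≠ u0 → ‖r u‖ = 1) ∧
      ∀ u, ‖u‖ = 1 → r u = u := by
  let d : E → E := fun u => ‖u - u0‖⁻¹ • (u - u0)
  let b : E → ℝ := fun u => inner ℝ u0 (d u)
  let t : E → ℝ := fun u => - b u + √(b u ^ 2 + (1 - ‖u0‖ ^ 2))
  have hn : ∀ u, u ≠ u0 → ‖u - u0‖ ≠ 0 := fun u hu => norm_ne_zero_iff.2 (sub_ne_zero.2 hu)
  have hd1 : ∀ u, u ≠ u0 → ‖d u‖ = 1 := by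
    intro u hu
    simp only [d]
    rw [norm_smul, norm_inv, norm_norm, inv_mul_cancel₀ (hn u hu)]
  have hpos : 0 < 1 - ‖u0‖ ^ 2 := by nlinarith [norm_nonneg u0]
  refine ⟨fun u => u0 + t u • d u, ?_, ?_, ?_⟩
  · have hd : ContinuousOn d {u0}ᶜ := by
      refine ContinuousOn.smul (ContinuousOn.inv₀ (by fun_prop) fun u hu => hn u hu) (by fun_prop)
    have hb : ContinuousOn b {u0}ᶜ := continuousOn_const.inner hd
    have ht : ContinuousOn t {u0}ᶜ :=
      hb.neg.add (((hb.pow 2).add continuousOn_const).sqrt)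
    exact continuousOn_const.add (ht.smul hd)
  · intro u hu
    have hs : √(b u ^ 2 + (1 - ‖u0‖ ^ 2)) ^ 2 = b u ^ 2 + (1 - ‖u0‖ ^ 2) :=
      Real.sq_sqrt (by positivity)
    have e : ‖u0 + t u • d u‖ ^ 2 = 1 := by
      rw [norm_add_sq_real, inner_smul_right, norm_smul, hd1 u hu, mul_one, Real.norm_eq_abs, sq_abs]
      change ‖u0‖ ^ 2 + 2 * (t u * b u) + t u ^ 2 = 1
      simp only [t]
      nlinarith
    have := norm_nonneg (u0 + t u • d u)
    nlinarith
  · intro u hu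
    have hne : u ≠ u0 := by rintro rfl; linarith
    have hp : 0 < ‖u - u0‖ := lt_of_le_of_ne (norm_nonneg _) (hn u hne).symm
    have hb : b u = ‖u - u0‖⁻¹ * (inner ℝ u0 u - ‖u0‖ ^ 2) := by
      simp only [b, d]; rw [inner_smul_right, inner_sub_right, real_inner_self_eq_norm_sq]
    have hsq : ‖u - u0‖ ^ 2 = 1 - 2 * inner ℝ u0 u + ‖u0‖ ^ 2 := by
      rw [norm_sub_sq_real, hu, real_inner_comm]; ring
    have hle : inner ℝ u0 u ≤ ‖u0‖ := by
      have := real_inner_le_norm u0 u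
      rwa [hu, mul_one] at this
    have hbm : b u * ‖u - u0‖ = inner ℝ u0 u - ‖u0‖ ^ 2 := by
      rw [hb]; field_simp
    have ht : t u = ‖u - u0‖ := by
      simp only [t]
      have : √(b u ^ 2 + (1 - ‖u0‖ ^ 2)) = ‖u - u0‖ + b u := by
        rw [Real.sqrt_eq_iff_mul_self_eq (by positivity)]
        · nlinarith
        · have : 0 < (‖u - u0‖ + b u) * ‖u - u0‖ := by nlinarith
          exact (pos_of_mul_pos_left this hp.le).le
      rw [this]; ring
    simp only [ht, d]
    rw [smul_smul, mul_inv_cancel₀ hp.ne', one_smul]; abel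

/-- The suspension target: the Euclidean product `V × ℝ`. -/
abbrev Susp (V : Type*) := WithLp 2 (V × ℝ)

/-- The map `ball → sphere` collapsing the boundary to the north pole. -/
noncomputable def sbar {V : Type*} [NormedAddCommGroup V] [InnerProductSpace ℝ V] (v : V) : Susp V :=
  WithLp.toLp 2 ((2 * √(1 - ‖v‖ ^ 2)) • v, 2 * ‖v‖ ^ 2 - 1)

/-- The north pole. -/
noncomputable def north (V : Type*) [NormedAddCommGroup V] [InnerProductSpace ℝ V] : Susp V :=
  WithLp.toLp 2 (0, 1)

section
variable {V : Type*} [NormedAddCommGroup V] [InnerProductSpace ℝ V]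

theorem sbar_continuous : Continuous (sbar : V → Susp V) := by
  unfold sbar
  fun_prop

theorem susp_norm_sq (x : Susp V) : ‖x‖ ^ 2 = ‖x.fst‖ ^ 2 + x.snd ^ 2 := by
  rw [WithLp.prod_norm_sq_eq_of_L2]; simp

theorem north_norm : ‖north V‖ = 1 := by
  have := susp_norm_sq (north V)
  simp [north] at this ⊢

theorem sbar_norm {v : V} (h : ‖v‖ ≤ 1) : ‖sbar v‖ = 1 := by
  have h1 := susp_norm_sq (sbar v)
  have h0 : 0 ≤ 1 - ‖v‖ ^ 2 := by nlinarith [norm_nonneg v]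
  have hs := Real.sq_sqrt h0
  have : ‖sbar v‖ ^ 2 = 1 := by
    rw [h1]
    change ‖(2 * √(1 - ‖v‖ ^ 2)) • v‖ ^ 2 + (2 * ‖v‖ ^ 2 - 1) ^ 2 = 1
    rw [norm_smul, mul_pow, Real.norm_eq_abs, sq_abs, mul_pow, hs]; ring
  have := norm_nonneg (sbar v)
  nlinarith

theorem sbar_of_norm_one {v : V} (h : ‖v‖ = 1) : sbar v = north V := by
  simp [sbar, north, h]; norm_num

theorem sbar_ne_north {v : V} (h : ‖v‖ < 1) : sbar v ≠ north V := by
  intro e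
  have : 2 * ‖v‖ ^ 2 - 1 = 1 := congrArg (fun x : Susp V => x.snd) e
  nlinarith [norm_nonneg v]

theorem sbar_inj {v w : V} (hv : ‖v‖ < 1) (hw : ‖w‖ < 1) (e : sbar v = sbar w) : v = w := by
  have h2 : 2 * ‖v‖ ^ 2 - 1 = 2 * ‖w‖ ^ 2 - 1 := congrArg (fun x : Susp V => x.snd) e
  have h3 : ‖v‖ ^ 2 = ‖w‖ ^ 2 := by linarith
  have h1 : (2 * √(1 - ‖v‖ ^ 2)) • v = (2 * √(1 - ‖w‖ ^ 2)) • w :=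
    congrArg (fun x : Susp V => x.fst) e
  rw [h3] at h1
  have : 0 < √(1 - ‖w‖ ^ 2) := Real.sqrt_pos.2 (by nlinarith [norm_nonneg w])
  exact smul_right_injective V (by positivity : (2 * √(1 - ‖w‖ ^ 2)) ≠ 0) h1

theorem final_contra [FiniteDimensional ℝ V] {W : Type*} [NormedAddCommGroup W]
    [InnerProductSpace ℝ W] [FiniteDimensional ℝ W]
    (G1 G2 : V → W) (hG1 : ContinuousOn G1 (closedBall 0 1)) (hG2 : ContinuousOn G2 (closedBall 0 1))
    (hG12 : ∀ v, ‖v‖ = 1 → G1 v = G2 v)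
    (n1 : ∀ v, ‖v‖ ≤ 1 → ‖G1 v‖ = 1) (n2 : ∀ v, ‖v‖ ≤ 1 → ‖G2 v‖ = 1)
    (M0 : W → Susp V) (hM0 : ContinuousOn M0 (closedBall 0 1)) (hMn : ∀ w, ‖w‖ ≤ 1 → ‖M0 w‖ = 1)
    (e1 : ∀ v, ‖v‖ ≤ 1 → M0 (G1 v) = sbar ((1/2 : ℝ) • v))
    (e2 : ∀ v, ‖v‖ ≤ 1 → M0 (G2 v) ≠ sbar 0) : False := by
  classical
  -- the minimal height of the upper part
  have hMG2 : ContinuousOn (fun v => (M0 (G2 v)).snd) (closedBall 0 1) := by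
    have : ContinuousOn (fun v => M0 (G2 v)) (closedBall 0 1) :=
      hM0.comp hG2 fun v hv => by
        rw [mem_closedBall_zero_iff] at *; exact (n2 v hv).le
    exact (by fun_prop : Continuous fun x : Susp V => x.snd).comp_continuousOn this
  obtain ⟨v0, hv0, hmin⟩ := (isCompact_closedBall (0 : V) 1).exists_isMinOn ⟨0, by simp⟩ hMG2
  have hm : -1 < (M0 (G2 v0)).snd := by
    rw [mem_closedBall_zero_iff] at hv0
    have h1 := susp_norm_sq (M0 (G2 v0))
    rw [hMn _ (n2 v0 hv0).le] at h1
    have h2 : -1 ≤ (M0 (G2 v0)).snd := by nlinarith [sq_nonneg ‖(M0 (G2 v0)).fst‖]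
    refine lt_of_le_of_ne h2 fun h => e2 v0 hv0 ?_
    rw [← h] at h1
    have h3 : (M0 (G2 v0)).fst = 0 := by
      rw [← norm_eq_zero]; nlinarith [norm_nonneg (M0 (G2 v0)).fst]
    apply (WithLp.equiv 2 (V × ℝ)).injective
    refine Prod.ext ?_ ?_
    · simpa [sbar] using h3
    · simpa [sbar] using h.symm
  -- choose the shift `κ`
  obtain ⟨κ, hκ1, hκ2⟩ : ∃ κ : ℝ, -(M0 (G2 v0)).snd < κ ∧ κ < 1 := exists_between (by linarith)
  have hκ0 : -1 < κ := by
    have h1 := susp_norm_sq (M0 (G2 v0))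
    rw [mem_closedBall_zero_iff] at hv0
    rw [hMn _ (n2 v0 hv0).le] at h1
    have : (M0 (G2 v0)).snd ≤ 1 := by nlinarith [sq_nonneg ‖(M0 (G2 v0)).fst‖]
    linarith
  -- the map on the sphere
  let g : Susp V → W := fun x => if x.snd ≤ 0 then G1 x.fst else G2 x.fst
  have hfst : ∀ x : Susp V, ‖x‖ = 1 → ‖x.fst‖ ≤ 1 := by
    intro x hx
    have h1 := susp_norm_sq x
    rw [hx] at h1
    nlinarith [norm_nonneg x.fst, sq_nonneg x.snd]
  have hfc : Continuous fun x : Susp V => x.fst := by fun_prop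
  have hsc : Continuous fun x : Susp V => x.snd := by fun_prop
  have hg : ContinuousOn g (sphere 0 1) := by
    have hsp : sphere (0 : Susp V) 1 ⊆
        (sphere 0 1 ∩ {x | x.snd ≤ 0}) ∪ (sphere 0 1 ∩ {x | 0 ≤ x.snd}) := by
      intro x hx
      rcases le_total x.snd 0 with h | h
      · exact Or.inl ⟨hx, h⟩
      · exact Or.inr ⟨hx, h⟩
    refine ContinuousOn.mono (ContinuousOn.union_of_isClosed ?_ ?_
      (isClosed_sphere.inter (isClosed_le hsc continuous_const))
      (isClosed_sphere.inter (isClosed_le continuous_const hsc))) hsp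
    · refine (hG1.comp hfc.continuousOn (s := sphere 0 1 ∩ {x | x.snd ≤ 0}) fun x hx => ?_).congr
        fun x hx => ?_
      · simpa using hfst x (by simpa using hx.1)
      · have : x.snd ≤ 0 := hx.2
        simp [g, this]
    · refine (hG2.comp hfc.continuousOn (s := sphere 0 1 ∩ {x | 0 ≤ x.snd}) fun x hx => ?_).congr
        fun x hx => ?_
      · simpa using hfst x (by simpa using hx.1)
      · have h0 : 0 ≤ x.snd := hx.2
        by_cases h : x.snd ≤ 0
        · have hx0 : x.snd = 0 := le_antisymm h h0
          have hx1 : ‖x‖ = 1 := by simpa using hx.1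
          have h1 := susp_norm_sq x
          rw [hx0, hx1] at h1
          have : ‖x.fst‖ = 1 := by nlinarith [norm_nonneg x.fst]
          simp [g, h, hG12 _ this]
        · simp [g, h]
  let gc : C(sphere (0 : Susp V) 1, W) := ⟨fun x => g x, continuousOn_iff_continuous_domRestrict.1 hg⟩
  obtain ⟨Gt, hGt⟩ := ContinuousMap.exists_restrict_eq isClosed_sphere gc
  have hGt' : ∀ x, ‖x‖ = 1 → bwProj (Gt x) = g x := by
    intro x hx
    have : Gt x = g x := congrArg (fun m => m ⟨x, by simpa using hx⟩) hGt
    rw [this]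
    refine bwProj_eq (le_of_eq ?_)
    by_cases h : x.snd ≤ 0
    · simp only [g, h, if_true]; exact n1 _ (hfst x hx)
    · simp only [g, h, if_false]; exact n2 _ (hfst x hx)
  have hsn : ∀ y : Susp V, (y + κ • north V).snd = y.snd + κ := by
    intro y; simp [north]
  have hsf : ∀ y : Susp V, (y + κ • north V).fst = y.fst := by
    intro y; simp [north]
  refine bw_main (fun x : Susp V => M0 (bwProj (Gt x)) + κ • north V) ?_ ?_ ?_
  · apply Continuous.continuousOn
    exact (hM0.comp_continuous (bwProj_continuous.comp Gt.continuous) fun x => by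
      simpa using bwProj_norm _).add continuous_const
  · intro x _ h0
    have h1 := hMn _ (bwProj_norm (Gt x))
    have h2 : M0 (bwProj (Gt x)) = -(κ • north V) := eq_neg_of_add_eq_zero_left h0
    rw [h2, norm_neg, norm_smul, north_norm, mul_one, Real.norm_eq_abs] at h1
    have := abs_lt.2 ⟨hκ0, hκ2⟩
    linarith
  · intro x hx c hc h
    simp only [hGt' x hx] at h
    have hs : (M0 (g x)).snd + κ = - (c * x.snd) := by
      rw [← hsn, h]; simp
    have hf : (M0 (g x)).fst = - (c • x.fst) := by
      rw [← hsf, h]; simp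
    have hx1 := hfst x hx
    by_cases hxs : x.snd ≤ 0
    · simp only [g, hxs, if_true] at hs hf
      rw [e1 _ hx1] at hs hf
      have hp : 0 < 2 * √(1 - ‖(1/2 : ℝ) • x.fst‖ ^ 2) := by
        have : 0 < √(1 - ‖(1/2 : ℝ) • x.fst‖ ^ 2) := by
          apply Real.sqrt_pos.2
          rw [norm_smul]; norm_num
          nlinarith [norm_nonneg x.fst]
        linarith
      have hf' : (2 * √(1 - ‖(1/2 : ℝ) • x.fst‖ ^ 2)) • ((1/2 : ℝ) • x.fst) = - (c • x.fst) := hf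
      set a := 2 * √(1 - ‖(1/2 : ℝ) • x.fst‖ ^ 2)
      have h0 : (a * (1/2) + c) • x.fst = 0 := by
        rw [add_smul, mul_smul, hf']; simp
      have hx0 : x.fst = 0 := by
        rcases smul_eq_zero.1 h0 with h | h
        · nlinarith
        · exact h
      rw [hx0] at hs
      simp [sbar] at hs
      nlinarith
    · simp only [g, hxs, if_false] at hs
      push Not at hxs
      have := hmin (by simpa using hx1 : x.fst ∈ closedBall (0:V) 1)
      simp only [mem_ofPred_eq] at this
      nlinarith

end
end TopLemmas

namespace CWComplexCells

section Cells
variable {X : Type} [TopologicalSpace X] [T2Space X] (K : CWComplexCells X)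

theorem exists_cell (x : X) : ∃ (ρ : K.Cell) (u : EuclideanSpace ℝ (Fin (K.dim ρ))),
    ‖u‖ < 1 ∧ K.charMap ρ u = x := by
  have hx : x ∈ (⋃ τ : K.Cell, K.charMap τ '' ball 0 1) := by
    rw [K.cells_cover]; trivial
  obtain ⟨ρ, u, hu, rfl⟩ := mem_iUnion.1 hx
  exact ⟨ρ, u, by simpa using hu, rfl⟩

theorem cell_key {ρ μ : K.Cell} {u : EuclideanSpace ℝ (Fin (K.dim ρ))}
    {w : EuclideanSpace ℝ (Fin (K.dim μ))} (hu : ‖u‖ ≤ 1) (hw : ‖w‖ < 1)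
    (h : K.charMap ρ u = K.charMap μ w) :
    (ρ = μ ∧ ‖u‖ < 1) ∨ (K.dim μ < K.dim ρ ∧ ‖u‖ = 1) := by
  have uniq : ∀ (α β : K.Cell) (a : EuclideanSpace ℝ (Fin (K.dim α)))
      (b : EuclideanSpace ℝ (Fin (K.dim β))), ‖a‖ < 1 → ‖b‖ < 1 →
      K.charMap α a = K.charMap β b → α = β := by
    intro α β a b ha hb hab
    by_contra hne
    have hdis := K.cells_disjoint α β hne
    rw [Set.disjoint_left] at hdis
    exact hdis (a := K.charMap α a) ⟨a, by simpa using ha, rfl⟩ ⟨b, by simpa using hb, hab.symm⟩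
  rcases hu.lt_or_eq with hu' | hu'
  · exact Or.inl ⟨uniq _ _ _ _ hu' hw h, hu'⟩
  · right
    obtain ⟨I, -, hI, hs⟩ := K.sphere_subset ρ
    have := hs ⟨u, by simpa using hu', rfl⟩
    simp only [mem_iUnion] at this
    obtain ⟨α, hα, a, ha, hau⟩ := this
    have e : α = μ := uniq _ _ a w (by simpa using ha) hw (hau.trans h)
    exact ⟨e ▸ hI α hα, hu'⟩

theorem cell_inj {ρ : K.Cell} {u w : EuclideanSpace ℝ (Fin (K.dim ρ))} (hu : ‖u‖ ≤ 1)
    (hw : ‖w‖ < 1) (h : K.charMap ρ u = K.charMap ρ w) : u = w := by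
  rcases K.cell_key hu hw h with ⟨-, h1⟩ | ⟨h1, -⟩
  · exact K.charMap_injOn ρ (by simpa using h1) (by simpa using hw) h
  · exact absurd h1 (lt_irrefl _)

theorem glue {Z : Type*} [TopologicalSpace Z] (I : Set K.Cell) (hI : I.Finite) (P : Set X)
    (hP : P ⊆ ⋃ ρ ∈ I, K.charMap ρ '' closedBall 0 1) (f : X → Z)
    (hf : ∀ ρ ∈ I, ContinuousOn (fun u => f (K.charMap ρ u))
      (closedBall 0 1 ∩ K.charMap ρ ⁻¹' P)) : ContinuousOn f P := by
  rw [continuousOn_iff_isClosed]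
  intro C hC
  have h1 : ∀ ρ, ∃ t : Set (EuclideanSpace ℝ (Fin (K.dim ρ))), IsClosed t ∧ (ρ ∈ I →
      (fun u => f (K.charMap ρ u)) ⁻¹' C ∩ (closedBall 0 1 ∩ K.charMap ρ ⁻¹' P)
        = t ∩ (closedBall 0 1 ∩ K.charMap ρ ⁻¹' P)) := by
    intro ρ
    by_cases hρ : ρ ∈ I
    · obtain ⟨t, ht, e⟩ := continuousOn_iff_isClosed.1 (hf ρ hρ) C hC
      exact ⟨t, ht, fun _ => e⟩
    · exact ⟨∅, isClosed_empty, fun h => absurd h hρ⟩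
  choose t ht e using h1
  refine ⟨⋃ ρ ∈ I, K.charMap ρ '' (closedBall 0 1 ∩ t ρ), ?_, ?_⟩
  · refine hI.isClosed_biUnion fun ρ _ => IsCompact.isClosed ?_
    exact ((isCompact_closedBall _ _).inter_right (ht ρ)).image_of_continuousOn
      ((K.charMap_continuousOn ρ).mono inter_subset_left)
  · ext x
    constructor
    · rintro ⟨hx, hxP⟩
      refine ⟨?_, hxP⟩
      have := hP hxP
      simp only [mem_iUnion] at this ⊢
      obtain ⟨ρ, hρ, u, hu, rfl⟩ := this
      refine ⟨ρ, hρ, u, ⟨hu, ?_⟩, rfl⟩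
      have h2 : u ∈ (fun u => f (K.charMap ρ u)) ⁻¹' C ∩ (closedBall 0 1 ∩ K.charMap ρ ⁻¹' P) :=
        ⟨hx, hu, hxP⟩
      rw [e ρ hρ] at h2
      exact h2.1
    · rintro ⟨hx, hxP⟩
      refine ⟨?_, hxP⟩
      simp only [mem_iUnion] at hx
      obtain ⟨ρ, hρ, u, ⟨hu, hut⟩, rfl⟩ := hx
      have h2 : u ∈ t ρ ∩ (closedBall 0 1 ∩ K.charMap ρ ⁻¹' P) := ⟨hut, hu, hxP⟩
      rw [← e ρ hρ] at h2
      exact h2.1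

open Classical in
/-- The collapse map of the cell `ν`. -/
noncomputable def cmap (ν : K.Cell) (x : X) : Susp (EuclideanSpace ℝ (Fin (K.dim ν))) :=
  if h : ∃ v, ‖v‖ < 1 ∧ K.charMap ν v = x then sbar h.choose else north _

theorem cmap_ball {ν : K.Cell} {v : EuclideanSpace ℝ (Fin (K.dim ν))} (hv : ‖v‖ < 1) :
    K.cmap ν (K.charMap ν v) = sbar v := by
  have h : ∃ w, ‖w‖ < 1 ∧ K.charMap ν w = K.charMap ν v := ⟨v, hv, rfl⟩
  rw [cmap, dif_pos h, K.cell_inj h.choose_spec.1.le hv h.choose_spec.2]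

theorem cmap_other {ν : K.Cell} {x : X} (h : ¬ ∃ v, ‖v‖ < 1 ∧ K.charMap ν v = x) :
    K.cmap ν x = north _ := by
  rw [cmap, dif_neg h]

theorem cmap_norm (ν : K.Cell) (x : X) : ‖K.cmap ν x‖ = 1 := by
  by_cases h : ∃ v, ‖v‖ < 1 ∧ K.charMap ν v = x
  · obtain ⟨v, hv, rfl⟩ := h
    rw [K.cmap_ball hv, sbar_norm hv.le]
  · rw [K.cmap_other h, north_norm]

theorem cmap_eq {ν : K.Cell} {x : X} {v : EuclideanSpace ℝ (Fin (K.dim ν))} (hv : ‖v‖ < 1)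
    (h : K.cmap ν x = sbar v) : x = K.charMap ν v := by
  by_cases hx : ∃ v, ‖v‖ < 1 ∧ K.charMap ν v = x
  · obtain ⟨w, hw, rfl⟩ := hx
    rw [K.cmap_ball hw] at h
    rw [sbar_inj hw hv h]
  · rw [K.cmap_other hx] at h
    exact absurd h.symm (sbar_ne_north hv)

theorem cmap_low {ν μ : K.Cell} (h : K.dim μ ≤ K.dim ν) :
    ContinuousOn (fun u => K.cmap ν (K.charMap μ u)) (closedBall 0 1) := by
  by_cases hμ : μ = ν
  · subst hμ
    refine sbar_continuous.continuousOn.congr fun u hu => ?_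
    rw [mem_closedBall_zero_iff] at hu
    rcases hu.lt_or_eq with h1 | h1
    · exact K.cmap_ball h1
    · rw [sbar_of_norm_one h1]
      refine K.cmap_other ?_
      rintro ⟨v, hv, e⟩
      have := K.cell_inj hu hv e.symm
      subst this
      linarith
  · refine (continuousOn_const (c := north _)).congr fun u hu => ?_
    rw [mem_closedBall_zero_iff] at hu
    refine K.cmap_other ?_
    rintro ⟨v, hv, e⟩
    rcases K.cell_key hu hv e.symm with ⟨h1, -⟩ | ⟨h1, -⟩
    · exact hμ h1
    · omega

theorem cmap_sphere {ν ρ : K.Cell} (h : K.dim ρ = K.dim ν + 1) :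
    ContinuousOn (fun u => K.cmap ν (K.charMap ρ u)) (sphere 0 1) := by
  obtain ⟨I, hI, hd, hs⟩ := K.sphere_subset ρ
  have h1 : ContinuousOn (K.cmap ν) (K.charMap ρ '' sphere 0 1) := by
    refine K.glue I hI _ (hs.trans ?_) _ fun μ hμ => ?_
    · exact iUnion₂_mono fun μ _ => image_mono ball_subset_closedBall
    · refine (K.cmap_low ?_).mono inter_subset_left
      have := hd μ hμ
      omega
  exact h1.comp ((K.charMap_continuousOn ρ).mono sphere_subset_closedBall) (mapsTo_image _ _)

theorem exists_Phi (ν ρ : K.Cell) (P : Set X) (hd : K.dim ρ ≤ K.dim ν + 1)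
    (h : K.dim ρ = K.dim ν + 1 →
      (∃ u0 : EuclideanSpace ℝ (Fin (K.dim ρ)), ‖u0‖ < 1 ∧ K.charMap ρ u0 ∉ P) ∨
      ∃ v0 : EuclideanSpace ℝ (Fin (K.dim ν)), ‖v0‖ < 1 ∧
        ∀ u : EuclideanSpace ℝ (Fin (K.dim ρ)), ‖u‖ ≤ 1 → K.charMap ρ u ≠ K.charMap ν v0) :
    ∃ Φ : EuclideanSpace ℝ (Fin (K.dim ρ)) → Susp (EuclideanSpace ℝ (Fin (K.dim ν))),
      (∀ u, ‖u‖ ≤ 1 → K.charMap ρ u ∈ P → ‖Φ u‖ = 1) ∧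
      ContinuousOn Φ (closedBall 0 1 ∩ K.charMap ρ ⁻¹' P) ∧
      (∀ u, ‖u‖ = 1 → Φ u = K.cmap ν (K.charMap ρ u)) ∧
      (K.dim ρ ≤ K.dim ν → ∀ u, ‖u‖ ≤ 1 → Φ u = K.cmap ν (K.charMap ρ u)) := by
  rcases hd.lt_or_eq with hlt | heq
  · refine ⟨fun u => K.cmap ν (K.charMap ρ u), fun u _ _ => K.cmap_norm _ _, ?_, fun _ _ => rfl,
      fun _ _ _ => rfl⟩
    exact (K.cmap_low (by omega)).mono inter_subset_left
  · rcases h heq with ⟨u0, hu0, hP⟩ | ⟨v0, hv0, hv⟩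
    · obtain ⟨r, hr, hr1, hr2⟩ := retr_sphere u0 hu0
      refine ⟨fun u => K.cmap ν (K.charMap ρ (r u)), fun u _ _ => K.cmap_norm _ _, ?_,
        fun u hu => ?_, fun h => by omega⟩
      · have hne : ∀ u ∈ closedBall 0 1 ∩ K.charMap ρ ⁻¹' P, u ≠ u0 := by
          rintro u ⟨-, hu⟩ rfl
          exact hP hu
        exact (K.cmap_sphere heq).comp (hr.mono hne) fun u hu => by
          simpa using hr1 u (hne u hu)
      · simp only [hr2 u hu]
    · obtain ⟨g, hg, hg1, -, hg3⟩ := tz_sphere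
        (isClosed_sphere (x := (0 : EuclideanSpace ℝ (Fin (K.dim ρ)))) (ε := 1))
        (fun u => K.cmap ν (K.charMap ρ u)) (K.cmap_sphere heq) (sbar v0) (sbar_norm hv0.le)
        (fun _ _ => K.cmap_norm _ _) (fun u hu e => by
          rw [mem_sphere_zero_iff_norm] at hu
          exact hv u hu.le (K.cmap_eq hv0 e))
      exact ⟨g, fun u _ _ => hg1 u, hg.continuousOn, fun u hu => hg3 u (by simpa using hu),
        fun h => by omega⟩

theorem exists_pi (ν τ : K.Cell) (P : Set X) (hτ : K.dim τ = K.dim ν + 2)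
    (hP : P ⊆ K.charMap τ '' sphere 0 1)
    (h : ∀ ρ, K.dim ρ = K.dim ν + 1 →
      (∃ u0 : EuclideanSpace ℝ (Fin (K.dim ρ)), ‖u0‖ < 1 ∧ K.charMap ρ u0 ∉ P) ∨
      ∃ v0 : EuclideanSpace ℝ (Fin (K.dim ν)), ‖v0‖ < 1 ∧
        ∀ u : EuclideanSpace ℝ (Fin (K.dim ρ)), ‖u‖ ≤ 1 → K.charMap ρ u ≠ K.charMap ν v0) :
    ∃ p : X → Susp (EuclideanSpace ℝ (Fin (K.dim ν))),
      ContinuousOn p P ∧ (∀ x ∈ P, ‖p x‖ = 1) ∧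
      ∀ (ρ : K.Cell) (u : EuclideanSpace ℝ (Fin (K.dim ρ))), K.dim ρ = K.dim ν + 1 → ‖u‖ = 1 →
        p (K.charMap ρ u) = K.cmap ν (K.charMap ρ u) := by
  have h1 : ∀ ρ : K.Cell,
    ∃ Φ : EuclideanSpace ℝ (Fin (K.dim ρ)) → Susp (EuclideanSpace ℝ (Fin (K.dim ν))),
      K.dim ρ ≤ K.dim ν + 1 →
      (∀ u, ‖u‖ ≤ 1 → K.charMap ρ u ∈ P → ‖Φ u‖ = 1) ∧
      ContinuousOn Φ (closedBall 0 1 ∩ K.charMap ρ ⁻¹' P) ∧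
      (∀ u, ‖u‖ = 1 → Φ u = K.cmap ν (K.charMap ρ u)) ∧
      (K.dim ρ ≤ K.dim ν → ∀ u, ‖u‖ ≤ 1 → Φ u = K.cmap ν (K.charMap ρ u)) := by
    intro ρ
    by_cases hd : K.dim ρ ≤ K.dim ν + 1
    · obtain ⟨Φ, hΦ⟩ := K.exists_Phi ν ρ P hd (h ρ)
      exact ⟨Φ, fun _ => hΦ⟩
    · exact ⟨fun _ => 0, fun h => absurd h hd⟩
  choose Φ hΦ using h1
  have h2 : ∀ x : X, ∃ y : Susp (EuclideanSpace ℝ (Fin (K.dim ν))),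
      ∀ (ρ : K.Cell) (u : EuclideanSpace ℝ (Fin (K.dim ρ))), K.dim ρ ≤ K.dim ν + 1 → ‖u‖ ≤ 1 →
        K.charMap ρ u = x → y = Φ ρ u := by
    intro x
    obtain ⟨μ, w, hw, rfl⟩ := K.exists_cell x
    refine ⟨Φ μ w, fun ρ u hd hu e => ?_⟩
    rcases K.cell_key hu hw e with ⟨h3, -⟩ | ⟨h3, h4⟩
    · subst h3
      rw [K.cell_inj hu hw e]
    · rw [(hΦ μ (by omega)).2.2.2 (by omega) w hw.le, (hΦ ρ hd).2.2.1 u h4, e]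
  choose p hp using h2
  have hp' : ∀ (ρ : K.Cell) (u : EuclideanSpace ℝ (Fin (K.dim ρ))), K.dim ρ ≤ K.dim ν + 1 →
      ‖u‖ ≤ 1 → p (K.charMap ρ u) = Φ ρ u := fun ρ u hd hu => hp _ ρ u hd hu rfl
  obtain ⟨I, hI, hd, hs⟩ := K.sphere_subset τ
  refine ⟨p, ?_, ?_, ?_⟩
  · refine K.glue I hI P ((hP.trans hs).trans ?_) p fun μ hμ => ?_
    · exact iUnion₂_mono fun μ _ => image_mono ball_subset_closedBall
    · have := hd μ hμ
      refine (hΦ μ (by omega)).2.1.congr fun u hu => ?_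
      exact hp' μ u (by omega) (by simpa using hu.1)
  · intro x hx
    have := hs (hP hx)
    simp only [mem_iUnion] at this
    obtain ⟨μ, hμ, u, hu, rfl⟩ := this
    have := hd μ hμ
    rw [mem_ball_zero_iff] at hu
    rw [hp' μ u (by omega) hu.le]
    exact (hΦ μ (by omega)).1 u hu.le hx
  · intro ρ u h3 h4
    rw [hp' ρ u h3.le h4.le]
    exact (hΦ ρ h3.le).2.2.1 u h4

theorem exists_section {σ τ : K.Cell} (hd : K.dim σ < K.dim τ) (h : K.RegularFace σ τ) :
    ∃ s : EuclideanSpace ℝ (Fin (K.dim σ)) → EuclideanSpace ℝ (Fin (K.dim τ)),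
      ContinuousOn s (ball 0 1) ∧
      (∀ v, ‖v‖ < 1 → ‖s v‖ = 1 ∧ K.charMap τ (s v) = K.charMap σ v) ∧
      ∀ v w, ‖v‖ < 1 → ‖w‖ ≤ 1 → K.charMap τ w = K.charMap σ v → w = s v := by
  classical
  obtain ⟨-, ⟨e, he⟩, -⟩ := h
  let q : ball (0 : EuclideanSpace ℝ (Fin (K.dim σ))) 1 → K.cellSet σ :=
    fun v => ⟨K.charMap σ v, v, v.2, rfl⟩
  have hq : Continuous q := by
    refine Continuous.subtype_mk ?_ _
    exact continuousOn_iff_continuous_domRestrict.1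
      ((K.charMap_continuousOn σ).mono ball_subset_closedBall)
  let s : EuclideanSpace ℝ (Fin (K.dim σ)) → EuclideanSpace ℝ (Fin (K.dim τ)) :=
    fun v => if hv : v ∈ ball 0 1 then (e.symm (q ⟨v, hv⟩) : _) else 0
  have hs : ∀ v (hv : v ∈ ball 0 1), s v = (e.symm (q ⟨v, hv⟩) : _) := fun v hv => by
    simp only [s]; rw [dif_pos hv]
  have hχ : ∀ v, ‖v‖ < 1 → K.charMap τ (s v) = K.charMap σ v := by
    intro v hv
    rw [hs v (by simpa using hv), ← he, e.apply_symm_apply]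
  refine ⟨s, ?_, ?_, ?_⟩
  · rw [continuousOn_iff_continuous_domRestrict]
    have : Continuous fun v => ((e.symm (q v) : K.preim σ τ) : EuclideanSpace ℝ (Fin (K.dim τ))) :=
      continuous_subtype_val.comp (e.symm.continuous.comp hq)
    convert this using 1
    ext1 v
    exact hs v.1 v.2
  · intro v hv
    refine ⟨?_, hχ v hv⟩
    have h1 : ‖s v‖ ≤ 1 := by
      rw [hs v (by simpa using hv)]
      simpa using (e.symm (q ⟨v, by simpa using hv⟩)).2.1
    rcases K.cell_key h1 hv (hχ v hv) with ⟨h2, -⟩ | ⟨-, h2⟩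
    · subst h2; omega
    · exact h2
  · intro v w hv hw hwv
    have hwp : w ∈ K.preim σ τ := ⟨by simpa using hw, v, by simpa using hv, hwv.symm⟩
    have : e ⟨w, hwp⟩ = q ⟨v, by simpa using hv⟩ := Subtype.ext ((he _).trans hwv)
    rw [hs v (by simpa using hv), ← this, e.symm_apply_apply]

theorem exists_other {ν σ τ : K.Cell} (h1 : K.RegularFace ν σ) (h2 : K.RegularFace σ τ)
    (d1 : K.dim ν + 1 = K.dim σ) (d2 : K.dim σ + 1 = K.dim τ) :
    ∃ σ', σ' ≠ σ ∧ K.Facet ν σ' ∧ K.Facet σ' τ := by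
  classical
  by_contra hcon
  push Not at hcon
  obtain ⟨s, hs, hs1, hs2⟩ := K.exists_section (by omega) h2
  obtain ⟨r, hr, hr1, hr2⟩ := K.exists_section (by omega) h1
  have z1 : ‖(0 : EuclideanSpace ℝ (Fin (K.dim σ)))‖ < 1 := by simp
  have z2 : ‖(0 : EuclideanSpace ℝ (Fin (K.dim ν)))‖ < 1 := by simp
  set P : Set X := K.charMap τ '' sphere 0 1 \ {K.charMap σ 0} with hPdef
  have hPs : P ⊆ K.charMap τ '' sphere 0 1 := diff_subset
  obtain ⟨p, hp, hpn, hpc⟩ := K.exists_pi ν τ P (by omega) hPs (by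
    intro ρ hρ
    by_cases hu : ∃ u0 : EuclideanSpace ℝ (Fin (K.dim ρ)), ‖u0‖ < 1 ∧ K.charMap ρ u0 ∉ P
    · exact Or.inl hu
    right
    push Not at hu
    have hne : ρ ≠ σ := by
      rintro rfl
      exact (hu 0 z1).2 rfl
    have hfac : K.Facet ρ τ := by
      refine ⟨?_, by omega⟩
      rintro x ⟨u, hu1, rfl⟩
      rw [mem_ball_zero_iff] at hu1
      refine ⟨?_, ?_⟩
      · rw [cellSet, K.closure_cell]
        exact image_mono sphere_subset_closedBall (hPs (hu u hu1))
      · rintro ⟨w, hw, e⟩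
        rw [mem_ball_zero_iff] at hw
        rcases K.cell_key hw.le hu1 e with ⟨h3, -⟩ | ⟨-, h3⟩
        · subst h3; omega
        · linarith
    have hnf : ¬ K.Facet ν ρ := fun h => hcon ρ hne h hfac
    have hnf' : ¬ K.cellSet ν ⊆ closure (K.cellSet ρ) \ K.cellSet ρ :=
      fun h => hnf ⟨h, by omega⟩
    obtain ⟨x, ⟨v0, hv0, rfl⟩, hx⟩ := not_subset.1 hnf'
    rw [mem_ball_zero_iff] at hv0
    refine ⟨v0, hv0, fun u hu1 e => hx ⟨?_, ?_⟩⟩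
    · rw [cellSet, K.closure_cell]
      exact ⟨u, by simpa using hu1, e⟩
    · rintro ⟨w, hw, e'⟩
      rw [mem_ball_zero_iff] at hw
      rcases K.cell_key hw.le hv0 e' with ⟨h3, -⟩ | ⟨-, h3⟩
      · subst h3; omega
      · linarith)
  -- points of `P`
  have hcl : K.charMap σ '' closedBall 0 1 ⊆ K.charMap τ '' sphere 0 1 := by
    rw [← K.closure_cell]
    refine closure_minimal ?_ ?_
    · rintro x ⟨u, hu, rfl⟩
      rw [mem_ball_zero_iff] at hu
      exact ⟨s u, by simpa using (hs1 u hu).1, (hs1 u hu).2⟩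
    · exact ((isCompact_sphere _ _).image_of_continuousOn
        ((K.charMap_continuousOn τ).mono sphere_subset_closedBall)).isClosed
  have hPσ : ∀ u, (1/2 : ℝ) ≤ ‖u‖ → ‖u‖ ≤ 1 → K.charMap σ u ∈ P := by
    intro u hu hu'
    refine ⟨hcl ⟨u, by simpa using hu', rfl⟩, fun e => ?_⟩
    have := K.cell_inj hu' z1 e
    rw [this, norm_zero] at hu
    linarith
  obtain ⟨J, hJ, hJ1, hJ2, hJ3⟩ := tz_sphere
    (isClosed_sphere (x := (0 : EuclideanSpace ℝ (Fin (K.dim σ)))) (ε := 1/2)) s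
    (hs.mono (sphere_subset_ball (by norm_num))) (s 0) (hs1 0 z1).1
    (fun u hu => by
      rw [mem_sphere_zero_iff_norm] at hu
      exact (hs1 u (by rw [hu]; norm_num)).1)
    (fun u hu e => by
      rw [mem_sphere_zero_iff_norm] at hu
      have h3 : ‖u‖ < 1 := by rw [hu]; norm_num
      have h4 : K.charMap σ u = K.charMap σ 0 := by
        rw [← (hs1 u h3).2, e, (hs1 0 z1).2]
      rw [K.cell_inj h3.le z1 h4, norm_zero] at hu
      norm_num at hu)
  have hPJ : ∀ u, K.charMap τ (J u) ∈ P := by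
    intro u
    refine ⟨⟨J u, by simpa using hJ1 u, rfl⟩, fun e => ?_⟩
    exact hJ2 u (hs2 0 (J u) z1 (hJ1 u).le e)
  -- the map on the closed ball of `σ`
  let M0 : EuclideanSpace ℝ (Fin (K.dim σ)) → Susp (EuclideanSpace ℝ (Fin (K.dim ν))) :=
    fun u => if (1/2 : ℝ) ≤ ‖u‖ then p (K.charMap σ u) else p (K.charMap τ (J u))
  have hM1 : ∀ u, ‖u‖ = 1 → M0 u = K.cmap ν (K.charMap σ u) := by
    intro u hu
    have : (1/2 : ℝ) ≤ ‖u‖ := by rw [hu]; norm_num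
    simp only [M0]
    rw [if_pos this]
    exact hpc σ u d1.symm hu
  have hM0 : ContinuousOn M0 (closedBall 0 1) := by
    have hsp : closedBall (0 : EuclideanSpace ℝ (Fin (K.dim σ))) 1 ⊆
        (closedBall 0 1 ∩ {x | (1/2 : ℝ) ≤ ‖x‖}) ∪ (closedBall 0 1 ∩ {x | ‖x‖ ≤ 1/2}) := by
      intro x hx
      rcases le_total (1/2 : ℝ) ‖x‖ with h | h
      · exact Or.inl ⟨hx, h⟩
      · exact Or.inr ⟨hx, h⟩
    refine ContinuousOn.mono (ContinuousOn.union_of_isClosed ?_ ?_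
      (isClosed_closedBall.inter (isClosed_le continuous_const continuous_norm))
      (isClosed_closedBall.inter (isClosed_le continuous_norm continuous_const))) hsp
    · refine (hp.comp ((K.charMap_continuousOn σ).mono inter_subset_left)
        (s := closedBall 0 1 ∩ {x | (1/2 : ℝ) ≤ ‖x‖}) fun u hu => ?_).congr fun u hu => ?_
      · exact hPσ u hu.2 (by simpa using hu.1)
      · exact if_pos hu.2
    · have hc : ContinuousOn (fun u => p (K.charMap τ (J u)))
          (closedBall 0 1 ∩ {x | ‖x‖ ≤ 1/2}) := by
        refine hp.comp ((K.charMap_continuousOn τ).comp hJ.continuousOn fun u _ => ?_)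
          fun u _ => hPJ u
        simpa using (hJ1 u).le
      refine hc.congr fun u hu => ?_
      by_cases h : (1/2 : ℝ) ≤ ‖u‖
      · have h3 : ‖u‖ = 1/2 := le_antisymm hu.2 h
        simp only [M0]
        rw [if_pos h, hJ3 u (by simpa using h3), (hs1 u (by rw [h3]; norm_num)).2]
      · exact if_neg h
  have hMn : ∀ w, ‖w‖ ≤ 1 → ‖M0 w‖ = 1 := by
    intro w hw
    simp only [M0]
    split_ifs with h
    · exact hpn _ (hPσ w h hw)
    · exact hpn _ (hPJ w)
  -- the two halves
  have hh : ∀ v : EuclideanSpace ℝ (Fin (K.dim ν)), ‖v‖ ≤ 1 → ‖(1/2 : ℝ) • v‖ < 1 := by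
    intro v hv
    rw [norm_smul]; norm_num; linarith
  have hG1 : ContinuousOn (fun v => r ((1/2 : ℝ) • v)) (closedBall 0 1) := by
    refine hr.comp (by fun_prop) fun v hv => ?_
    rw [mem_closedBall_zero_iff] at hv
    rw [mem_ball_zero_iff]
    exact hh v hv
  obtain ⟨G2, hG2, hG21, hG22, hG23⟩ := tz_sphere
    (isClosed_sphere (x := (0 : EuclideanSpace ℝ (Fin (K.dim ν)))) (ε := 1))
    (fun v => r ((1/2 : ℝ) • v)) (hG1.mono sphere_subset_closedBall) (r 0) (hr1 0 z2).1
    (fun v hv => by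
      rw [mem_sphere_zero_iff_norm] at hv
      exact (hr1 _ (hh v hv.le)).1)
    (fun v hv e => by
      rw [mem_sphere_zero_iff_norm] at hv
      have h4 : K.charMap ν ((1/2 : ℝ) • v) = K.charMap ν 0 := by
        rw [← (hr1 _ (hh v hv.le)).2, e, (hr1 0 z2).2]
      have h5 := K.cell_inj (hh v hv.le).le z2 h4
      have h6 : ‖(1/2 : ℝ) • v‖ = 0 := by rw [h5, norm_zero]
      rw [norm_smul, hv] at h6
      norm_num at h6)
  refine final_contra (fun v => r ((1/2 : ℝ) • v)) G2 hG1 hG2.continuousOn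
    (fun v hv => (hG23 v (by simpa using hv)).symm) (fun v hv => (hr1 _ (hh v hv)).1)
    (fun v _ => hG21 v) M0 hM0 hMn ?_ ?_
  · intro v hv
    obtain ⟨h3, h4⟩ := hr1 _ (hh v hv)
    rw [hM1 _ h3, h4, K.cmap_ball (hh v hv)]
  · intro v _ e
    rw [hM1 _ (hG21 v)] at e
    exact hG22 v (hr2 0 (G2 v) z2 (hG21 v).le (K.cmap_eq z2 e))

end Cells

section Comb
variable {X : Type} [TopologicalSpace X] [T2Space X] (K : CWComplexCells X)

theorem rpath_symm {f : K.Cell → ℝ} {r : ℝ} {a b : K.Cell} (h : K.RPath f r a b) :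
    f b = r ∧ K.RPath f r b a := by
  obtain ⟨ha, h⟩ := h
  induction h with
  | refl => exact ⟨ha, ha, .refl⟩
  | tail h1 h2 ih =>
    refine ⟨h2.2, h2.2, ?_⟩
    exact Relation.ReflTransGen.head ⟨Or.symm h2.1, ih.1⟩ ih.2.2

theorem rpath_trans {f : K.Cell → ℝ} {r : ℝ} {a b c : K.Cell} (h : K.RPath f r a b)
    (h' : K.RPath f r b c) : K.RPath f r a c := ⟨h.1, h.2.trans h'.2⟩

theorem isCollection_of (f : K.Cell → ℝ) (x : K.Cell) :
    K.IsCollection f {y | K.RPath f (f x) x y} := by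
  refine ⟨⟨f x, fun y hy => (K.rpath_symm hy).1, fun a ha b hb =>
    K.rpath_trans (K.rpath_symm ha).2 hb⟩, ?_⟩
  rintro C' hsub ⟨c, hc, hp⟩
  refine Subset.antisymm (fun y hy => ?_) hsub
  have hx : x ∈ C' := hsub ⟨rfl, .refl⟩
  have := hp x hx y hy
  rw [← hc x hx] at this
  exact this

theorem mem_of_adjacent {f : K.Cell → ℝ} {C : Set K.Cell} (hC : K.IsCollection f C)
    {a b : K.Cell} (ha : a ∈ C) (hab : K.Adjacent a b) (h : f b = f a) : b ∈ C := by
  obtain ⟨⟨c, hc, hp⟩, hmax⟩ := hC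
  have hca := hc a ha
  have hCe : {y | K.RPath f (f a) a y} = C := by
    refine hmax _ (fun y hy => ?_) (K.isCollection_of f a).1
    have := hp a ha y hy
    rw [← hca] at this
    exact this
  rw [← hCe]
  exact ⟨rfl, Relation.ReflTransGen.single ⟨hab, h⟩⟩

theorem not_both (f : K.Cell → ℝ) (hf : K.DiscreteMorseBott f)
    (C : Set K.Cell) (hC : K.IsCollection f C) (σ : K.Cell) (hσ : σ ∈ C)
    (hU : K.UC f C σ = 1) (hD : K.DC f C σ = 1) : False := by
  obtain ⟨τ, hτ⟩ := Set.encard_eq_one.1 hU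
  obtain ⟨ν, hν⟩ := Set.encard_eq_one.1 hD
  obtain ⟨hτC, hστ, hle1⟩ : τ ∈ K.UCset f C σ := by rw [hτ]; rfl
  obtain ⟨hνC, hνσ, hle2⟩ : ν ∈ K.DCset f C σ := by rw [hν]; rfl
  have l1 : f τ < f σ := lt_of_le_of_ne hle1 fun e =>
    hτC (K.mem_of_adjacent hC hσ (Or.inl hστ) e)
  have l2 : f σ < f ν := lt_of_le_of_ne hle2 fun e =>
    hνC (K.mem_of_adjacent hC hσ (Or.inr hνσ) e.symm)
  obtain ⟨m1, -, m3, -⟩ := hf C hC σ hσ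
  have r1 : K.RegularFace ν σ := by
    by_contra h
    exact lt_asymm l2 (m3 ν ⟨hνσ.1, h⟩)
  have r2 : K.RegularFace σ τ := by
    by_contra h
    exact lt_asymm l1 (m1 τ ⟨hστ.1, h⟩)
  obtain ⟨σ', hne, f1, f2⟩ := K.exists_other r1 r2 hνσ.2 hστ.2
  have hcν := K.isCollection_of f ν
  have hcτ := K.isCollection_of f τ
  have u1 := (hf _ hcν ν ⟨rfl, .refl⟩).2.1
  have u2 := (hf _ hcτ τ ⟨rfl, .refl⟩).2.2.2
  have hout : ∀ x y : K.Cell, f y ≠ f x → y ∉ {z | K.RPath f (f x) x z} :=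
    fun x y h hy => h (K.rpath_symm hy).1
  have g1 : f ν ≤ f σ' := by
    by_contra hlt
    push Not at hlt
    refine hne (Set.encard_le_one_iff.1 u1 σ' σ ?_ ?_)
    · exact ⟨hout _ _ hlt.ne, f1, hlt.le⟩
    · exact ⟨hout _ _ l2.ne, hνσ, l2.le⟩
  have g2 : f τ < f σ' := by linarith
  refine hne (Set.encard_le_one_iff.1 u2 σ' σ ?_ ?_)
  · exact ⟨hout _ _ g2.ne', f2, g2.le⟩
  · exact ⟨hout _ _ l1.ne', hστ, l1.le⟩

end Comb

end CWComplexCells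


/-- Lemma `exclude`: for a discrete Morse–Bott function `f`, a
collection `C ∈ 𝒞_f`, and a cell `σ ∈ C \ C^red`, exactly one of the following holds:
`σ` is upward noncritical; `σ` is downward noncritical. -/
theorem upward_xor_downward_noncritical {X : Type} [TopologicalSpace X] [T2Space X]
    (K : CWComplexCells X) (f : K.Cell → ℝ) (hf : K.DiscreteMorseBott f)
    (C : Set K.Cell) (hC : K.IsCollection f C) (σ : K.Cell) (hσ : σ ∈ C)
    (hσred : σ ∉ K.red f C) :
    Xor' (K.UC f C σ = 1) (K.DC f C σ = 1) := by
  have h := K.not_both f hf C hC σ hσ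
  by_cases hU : K.UC f C σ = 1
  · exact Or.inl ⟨hU, fun hD => h hU hD⟩
  · refine Or.inr ⟨?_, hU⟩
    by_contra hD
    exact hσred ⟨hσ, hU, hD⟩
end

section
/- Let V be a positively bounded combinatorial vector field on a CW complex K. The following are equivalent: (1) there is a discrete Morse function f : K → ℝ such that V = −∇f; (2) V has no closed orbits. -/
/-!
Set-based CW complexes: a CW complex is identified with the family of its cells.
Each `n`-cell `τ` has a characteristic map `charMap τ : D^n → X` (from the closed
unit disk of `EuclideanSpace ℝ (Fin n)`), the open cells partition `X`, the closure
of each cell is the image of the closed disk, the boundary sphere is mapped into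
finitely many cells of strictly lower dimension (closure finiteness), and `X`
carries the weak topology determined by the closed cells.
-/

open Metric Set

namespace CWComplexCells

variable {X : Type} [TopologicalSpace X] [T2Space X] (K : CWComplexCells X)

/-- A combinatorial vector field on `K`: a map `V : K → K ⊔ {0}` (here `Option K.Cell`)
such that `V(V(σ)) = 0` whenever defined, `σ ≺reg V(σ)` whenever `V(σ) ≠ 0`, and each
cell has at most one `V`-preimage. -/
def IsCombVF (V : K.Cell → Option K.Cell) : Prop :=
  (∀ σ τ, V σ = some τ → V τ = none) ∧
  (∀ σ τ, V σ = some τ → K.RegularFacet σ τ) ∧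
  (∀ τ : K.Cell, {σ | V σ = some τ}.Subsingleton)

/-- One step `σᵢ → τᵢ ≻ σᵢ₊₁` (with `σᵢ₊₁ ≠ σᵢ`) of a `V`-path. -/
def VStep (V : K.Cell → Option K.Cell) (σ σ' : K.Cell) : Prop :=
  ∃ τ, V σ = some τ ∧ K.Facet σ' τ ∧ σ' ≠ σ

/-- `γ` enumerates the cells `σ₀, σ₁, …, σᵣ` of a `V`-path
`σ₀ → τ₀ ≻ σ₁ → τ₁ ≻ ⋯ → τ_{r-1} ≻ σᵣ`. -/
def IsVPath (V : K.Cell → Option K.Cell) {r : ℕ} (γ : Fin (r + 1) → K.Cell) : Prop :=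
  ∀ i : Fin r, K.VStep V (γ i.castSucc) (γ i.succ)

/-- `V` is positively bounded: for every cell `σ`, the lengths of `V`-paths starting at
`σ` and containing no closed orbit (equivalently, with pairwise distinct `σᵢ`) are
bounded above. -/
def PositivelyBounded (V : K.Cell → Option K.Cell) : Prop :=
  ∀ σ : K.Cell, ∃ N : ℕ, ∀ (r : ℕ) (γ : Fin (r + 1) → K.Cell),
    K.IsVPath V γ → γ 0 = σ → Function.Injective γ → r ≤ N

/-- `V` has a closed orbit: a nonempty `V`-path returning to its starting cell. -/
def HasClosedOrbit (V : K.Cell → Option K.Cell) : Prop :=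
  ∃ σ : K.Cell, Relation.TransGen (K.VStep V) σ σ

end CWComplexCells

/-- Along a `V`-path of a field without closed orbits, no cell is repeated. -/
theorem CWComplexCells.IsVPath.injective_of_acyclic {X : Type} [TopologicalSpace X] [T2Space X]
    {K : CWComplexCells X} {V : K.Cell → Option K.Cell} (hac : ¬ K.HasClosedOrbit V)
    {r : ℕ} {γ : Fin (r + 1) → K.Cell} (h : K.IsVPath V γ) : Function.Injective γ := by
  have key := (Fin.liftFun_iff_succ (Relation.TransGen (K.VStep V)) (f := γ)).2
    (fun i => Relation.TransGen.single (h i))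
  intro i j hij
  rcases lt_trichotomy i j with hlt | heq | hgt
  · have := key hlt
    rw [hij] at this
    exact absurd ⟨_, this⟩ hac
  · exact heq
  · have := key hgt
    rw [hij] at this
    exact absurd ⟨_, this⟩ hac

/-- In the absence of closed orbits there is a natural number valued rank which
decreases along steps of `V`-paths. -/
theorem CWComplexCells.exists_rank {X : Type} [TopologicalSpace X] [T2Space X]
    (K : CWComplexCells X) (V : K.Cell → Option K.Cell)
    (hPB : K.PositivelyBounded V) (hac : ¬ K.HasClosedOrbit V) :
    ∃ l : K.Cell → ℕ, ∀ σ σ', K.VStep V σ σ' → l σ' < l σ := by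
  let S : K.Cell → Set ℕ := fun σ => {r | ∃ γ : Fin (r + 1) → K.Cell, K.IsVPath V γ ∧ γ 0 = σ}
  have hb : ∀ σ, BddAbove (S σ) := by
    intro σ
    obtain ⟨N, hN⟩ := hPB σ
    refine ⟨N, ?_⟩
    rintro r ⟨γ, hγ, h0⟩
    exact hN r γ hγ h0 (hγ.injective_of_acyclic hac)
  have hne : ∀ σ, (S σ).Nonempty := fun σ => ⟨0, fun _ => σ, fun i => i.elim0, rfl⟩
  refine ⟨fun σ => sSup (S σ), fun σ σ' hstep => ?_⟩
  obtain ⟨γ, hγ, h0⟩ := Nat.sSup_mem (hne σ') (hb σ')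
  refine Nat.lt_of_succ_le (le_csSup (hb σ) ⟨Fin.cons σ γ, ?_, rfl⟩)
  intro i
  refine Fin.cases ?_ (fun j => ?_) i
  · simpa [h0] using hstep
  · simpa using hγ j

/-- Lemma `lemgvf`: for a positively bounded combinatorial vector
field `V`, there is a discrete Morse function `f` with `V = −∇f` iff `V` has no closed
orbits. -/
theorem negGradient_iff_no_closed_orbit {X : Type} [TopologicalSpace X] [T2Space X]
    (K : CWComplexCells X) (V : K.Cell → Option K.Cell)
    (hV : K.IsCombVF V) (hPB : K.PositivelyBounded V) :
    (∃ f : K.Cell → ℝ, K.DiscreteMorse f ∧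
        ∀ σ τ : K.Cell, V σ = some τ ↔ (K.Facet σ τ ∧ f σ ≥ f τ)) ↔
      ¬ K.HasClosedOrbit V := by
  obtain ⟨h1, h2, h3⟩ := hV
  constructor
  · rintro ⟨f, -, hf⟩ ⟨σ, hσ⟩
    have hdec : ∀ a b, Relation.TransGen (K.VStep V) a b → f b < f a := by
      intro a b hab
      have hs : ∀ a b, K.VStep V a b → f b < f a := by
        rintro a b ⟨τ, hτ, hfac, hne⟩
        have ha := ((hf a τ).1 hτ).2
        by_contra! hcon
        exact hne (h3 τ ((hf b τ).2 ⟨hfac, le_trans ha hcon⟩) hτ)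
      induction hab with
      | single h => exact hs _ _ h
      | tail _ h ih => exact (hs _ _ h).trans ih
    exact lt_irrefl _ (hdec σ σ hσ)
  · intro hac
    obtain ⟨l, hl⟩ := K.exists_rank V hPB hac
    classical
    let h : K.Cell → ℝ := fun σ => (K.dim σ : ℝ) + (1 - 1 / ((l σ : ℝ) + 1))
    have hlow : ∀ σ, (K.dim σ : ℝ) ≤ h σ := by
      intro σ
      have : 1 / ((l σ : ℝ) + 1) ≤ 1 := by
        rw [div_le_one (by positivity)]
        linarith [Nat.cast_nonneg (α := ℝ) (l σ)]
      simp only [h]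
      linarith
    have hhigh : ∀ σ, h σ < (K.dim σ : ℝ) + 1 := by
      intro σ
      have : 0 < 1 / ((l σ : ℝ) + 1) := by positivity
      simp only [h]
      linarith
    let f : K.Cell → ℝ := fun τ => if e : ∃ σ, V σ = some τ then h e.choose else h τ
    have hf1 : ∀ σ τ, V σ = some τ → f τ = h σ := by
      intro σ τ hστ
      have e : ∃ σ, V σ = some τ := ⟨σ, hστ⟩
      have : f τ = h e.choose := dif_pos e
      rw [this, h3 τ e.choose_spec hστ]
    have hf2 : ∀ τ, (¬ ∃ σ, V σ = some τ) → f τ = h τ := fun τ e => dif_neg e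
    have hfle : ∀ τ, f τ < (K.dim τ : ℝ) + 1 := by
      intro τ
      by_cases e : ∃ σ, V σ = some τ
      · obtain ⟨σ, hσ⟩ := e
        rw [hf1 σ τ hσ]
        have hd := (h2 σ τ hσ).2
        have hd' : (K.dim σ : ℝ) + 1 = K.dim τ := by exact_mod_cast hd
        linarith [hhigh σ]
      · rw [hf2 τ e]
        exact hhigh τ
    have main : ∀ σ τ : K.Cell, V σ = some τ ↔ (K.Facet σ τ ∧ f σ ≥ f τ) := by
      intro α β
      constructor
      · intro hαβ
        refine ⟨⟨(h2 α β hαβ).1.1, (h2 α β hαβ).2⟩, ?_⟩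
        rw [hf1 α β hαβ, hf2 α]
        rintro ⟨γ, hγ⟩
        rw [h1 γ α hγ] at hαβ
        cases hαβ
      · rintro ⟨hfac, hge⟩
        by_contra hne
        have hd : (K.dim α : ℝ) + 1 = K.dim β := by exact_mod_cast hfac.2
        refine absurd hge (not_le.2 ?_)
        by_cases e : ∃ σ, V σ = some β
        · obtain ⟨σ, hσ⟩ := e
          rw [hf1 σ β hσ]
          have hdσ : K.dim σ = K.dim α := by
            have := (h2 σ β hσ).2
            have := hfac.2
            omega
          have hασ : α ≠ σ := by
            rintro rfl
            exact hne hσ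
          have hlt : (l α : ℝ) < l σ := by exact_mod_cast hl σ α ⟨β, hσ, hfac, hασ⟩
          by_cases e' : ∃ ν, V ν = some α
          · obtain ⟨ν, hν⟩ := e'
            rw [hf1 ν α hν]
            have hdν : (K.dim ν : ℝ) + 1 = K.dim α := by exact_mod_cast (h2 ν α hν).2
            have := hlow σ
            rw [hdσ] at this
            linarith [hhigh ν]
          · rw [hf2 α e']
            have : 1 / ((l σ : ℝ) + 1) < 1 / ((l α : ℝ) + 1) :=
              one_div_lt_one_div_of_lt (by positivity) (by linarith)
            simp only [h, hdσ]
            linarith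
        · rw [hf2 β e]
          linarith [hlow β, hfle α]
    refine ⟨f, fun σ => ⟨?_, ?_, ?_, ?_⟩, main⟩
    · intro τ hτ
      by_contra! hcon
      exact hτ.2 (h2 σ τ ((main σ τ).2 ⟨hτ.1, hcon⟩)).1
    · refine Set.encard_le_one_iff.2 fun a b ha hb => ?_
      have ha' := (main σ a).2 ha
      have hb' := (main σ b).2 hb
      exact Option.some.inj (ha'.symm.trans hb')
    · intro ν hν
      by_contra! hcon
      exact hν.2 (h2 ν σ ((main ν σ).2 ⟨hν.1, hcon⟩)).1
    · refine Set.encard_le_one_iff.2 fun a b ha hb => ?_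
      exact h3 σ ((main a σ).2 ha) ((main b σ).2 hb)
end

section
/- Let f : K → ℝ be a discrete Morse–Bott function on a CW complex K such that the combinatorial vector field −∇_s f is positively bounded. Then there exists a discrete Morse function g : K → ℝ with −∇_s f = −∇g. -/
/-!
Set-based CW complexes: a CW complex is identified with the family of its cells.
Each `n`-cell `τ` has a characteristic map `charMap τ : D^n → X` (from the closed
unit disk of `EuclideanSpace ℝ (Fin n)`), the open cells partition `X`, the closure
of each cell is the image of the closed disk, the boundary sphere is mapped into
finitely many cells of strictly lower dimension (closure finiteness), and `X`
carries the weak topology determined by the closed cells.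
-/

open Metric Set

namespace CWComplexCells

variable {X : Type} [TopologicalSpace X] [T2Space X] (K : CWComplexCells X)

theorem finite_facets (τ : K.Cell) : {ν | K.Facet ν τ}.Finite := by
  obtain ⟨I, hI, -, hs⟩ := K.sphere_subset τ
  refine hI.subset ?_
  rintro ν ⟨hν, -⟩
  have h0 : K.charMap ν 0 ∈ K.cellSet ν := ⟨0, by simp, rfl⟩
  obtain ⟨hc, hn⟩ := hν h0
  unfold cellSet at hc hn
  rw [K.closure_cell] at hc
  obtain ⟨x, hx, hxe⟩ := hc
  have hxs : x ∈ sphere (0 : EuclideanSpace ℝ (Fin (K.dim τ))) 1 := by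
    rcases (mem_closedBall.1 hx).lt_or_eq with h | h
    · exact absurd ⟨x, mem_ball.2 h, hxe⟩ hn
    · exact h
  have := hs ⟨x, hxs, hxe⟩
  simp only [mem_iUnion] at this
  obtain ⟨σ, hσ, hm⟩ := this
  by_cases h : σ = ν
  · exact h ▸ hσ
  · exact absurd h0 (Set.disjoint_left.1 (K.cells_disjoint σ ν h) hm)

/-- `z` is strictly `f`-below `y` and adjacent to it. -/
def Drop (f : K.Cell → ℝ) (z y : K.Cell) : Prop :=
  (K.Facet z y ∨ K.Facet y z) ∧ f z < f y

/-- All `f`-drops from cells reachable from `x` within its level by passing to facets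
have value at most `t`. -/
def Good (f : K.Cell → ℝ) (t : ℝ) (x : K.Cell) : Prop :=
  ∀ y, Relation.ReflTransGen (fun a b => K.Facet b a ∧ f b = f a) x y →
    ∀ z, K.Drop f z y → f z ≤ t

theorem Good.mono {f : K.Cell → ℝ} {s t : ℝ} {x : K.Cell} (h : K.Good f s x) (hst : s ≤ t) :
    K.Good f t x := fun y hy z hz => (h y hy z hz).trans hst

theorem Good.facet {f : K.Cell → ℝ} {t : ℝ} {x y : K.Cell} (h : K.Good f t x)
    (hf : K.Facet y x) (he : f y = f x) : K.Good f t y :=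
  fun w hw z hz => h w (Relation.ReflTransGen.head ⟨hf, he⟩ hw) z hz

theorem good_iff {f : K.Cell → ℝ} {t : ℝ} {x : K.Cell} (h1 : ∀ z, K.Drop f z x → f z ≤ t)
    (h2 : ∀ y, K.Facet y x → f y = f x → K.Good f t y) : K.Good f t x := by
  intro y hy z hz
  rcases Relation.ReflTransGen.cases_head hy with h | ⟨w, ⟨hw, he⟩, hwy⟩
  · subst h; exact h1 z hz
  · exact h2 w hw he y hwy z hz

theorem exists_bound {S : Set K.Cell} (hS : S.Finite) (P : K.Cell → ℝ → Prop)
    (hP : ∀ y s t, P y s → s ≤ t → P y t) (c : ℝ) (h : ∀ y ∈ S, ∃ t < c, P y t) :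
    ∃ t < c, ∀ y ∈ S, P y t := by
  induction S, hS using Set.Finite.induction_on with
  | empty => exact ⟨c - 1, by linarith, by simp⟩
  | insert _ _ ih =>
    obtain ⟨t, ht, h1⟩ := ih (fun y hy => h y (Set.mem_insert_of_mem _ hy))
    obtain ⟨s, hs, h2⟩ := h _ (Set.mem_insert _ _)
    refine ⟨max s t, max_lt hs ht, ?_⟩
    rintro y (rfl | hy)
    · exact hP _ _ _ h2 (le_max_left _ _)
    · exact hP _ _ _ (h1 y hy) (le_max_right _ _)

theorem exists_good {f : K.Cell → ℝ}
    (hU : ∀ σ : K.Cell, {τ | K.Facet σ τ ∧ f τ < f σ}.Finite) :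
    ∀ (n : ℕ) (x : K.Cell), K.dim x = n → ∃ t < f x, K.Good f t x := by
  intro n
  induction n using Nat.strong_induction_on with
  | _ n ih =>
  intro x hx
  obtain ⟨t1, ht1, h1⟩ := K.exists_bound (K.finite_facets x)
    (fun y t => (f y < f x → f y ≤ t) ∧ (f y = f x → K.Good f t y))
    (fun y s t h hst => ⟨fun hh => (h.1 hh).trans hst, fun hh => Good.mono K (h.2 hh) hst⟩)
    (f x) (by
      intro y hy
      rcases lt_trichotomy (f y) (f x) with h | h | h
      · exact ⟨f y, h, fun _ => le_rfl, fun hh => absurd hh h.ne⟩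
      · obtain ⟨t, ht, hg⟩ := ih (K.dim y) (by have := hy.2; omega) y rfl
        exact ⟨t, h ▸ ht, fun hh => absurd h hh.ne, fun _ => hg⟩
      · exact ⟨f x - 1, by linarith, fun hh => absurd hh h.not_gt, fun hh => absurd hh h.ne'⟩)
  obtain ⟨t2, ht2, h2⟩ := K.exists_bound (hU x) (fun y t => f y ≤ t)
    (fun y s t h hst => h.trans hst) (f x) (fun y hy => ⟨f y, hy.2, le_rfl⟩)
  refine ⟨max t1 t2, max_lt ht1 ht2, K.good_iff ?_ ?_⟩
  · rintro z ⟨hz | hz, hlt⟩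
    · exact ((h1 z hz).1 hlt).trans (le_max_left _ _)
    · exact (h2 z ⟨hz, hlt⟩).trans (le_max_right _ _)
  · intro y hy he
    exact Good.mono K ((h1 y hy).2 he) (le_max_left _ _)

open Classical in
/-- A bounded function monotone along the descent relation, resolving ties just above `q`. -/
noncomputable def phi (f : K.Cell → ℝ) (q : ℝ) (x : K.Cell) : ℝ :=
  if f x ≤ q then 0 else if K.Good f q x then 1 - 1 / ((K.dim x : ℝ) + 2) else 1

theorem frac_bounds (n : ℕ) : 0 < 1 / ((n : ℝ) + 2) ∧ 1 / ((n : ℝ) + 2) < 1 := by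
  have : (0 : ℝ) ≤ n := n.cast_nonneg
  refine ⟨by positivity, ?_⟩
  rw [div_lt_one (by linarith)]
  linarith

theorem phi_nonneg (f : K.Cell → ℝ) (q : ℝ) (x : K.Cell) : 0 ≤ K.phi f q x := by
  have := frac_bounds (K.dim x)
  unfold phi
  split_ifs <;> linarith

theorem phi_le_one (f : K.Cell → ℝ) (q : ℝ) (x : K.Cell) : K.phi f q x ≤ 1 := by
  have := frac_bounds (K.dim x)
  unfold phi
  split_ifs <;> linarith

theorem phi_pos (f : K.Cell → ℝ) (q : ℝ) (x : K.Cell) (h : q < f x) : 0 < K.phi f q x := by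
  have := frac_bounds (K.dim x)
  unfold phi
  split_ifs <;> linarith

/-- The descent relation. -/
def Below (f : K.Cell → ℝ) (y x : K.Cell) : Prop :=
  K.Drop f y x ∨ (K.Facet y x ∧ f y = f x)

theorem frac_lt {y x : K.Cell} (h : K.Facet y x) :
    1 / ((K.dim x : ℝ) + 2) < 1 / ((K.dim y : ℝ) + 2) := by
  have h2 : (K.dim y : ℝ) + 1 = K.dim x := by exact_mod_cast h.2
  have : (0 : ℝ) ≤ K.dim y := Nat.cast_nonneg _
  apply one_div_lt_one_div_of_lt <;> linarith

theorem phi_mono {f : K.Cell → ℝ} (q : ℝ) {y x : K.Cell} (h : K.Below f y x) :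
    K.phi f q y ≤ K.phi f q x := by
  by_cases hy : f y ≤ q
  · have : K.phi f q y = 0 := by simp [phi, hy]
    rw [this]; exact K.phi_nonneg f q x
  have hle : f y ≤ f x := by
    rcases h with h | h
    · exact h.2.le
    · exact h.2.le
  have hx : ¬ f x ≤ q := fun hh => hy (hle.trans hh)
  by_cases hg : K.Good f q x
  · rcases h with h | h
    · exact absurd (hg x Relation.ReflTransGen.refl y h) hy
    · have hgy := Good.facet K hg h.1 h.2
      have := K.frac_lt h.1
      simp only [phi, hy, hx, hg, hgy, if_true, if_false]
      linarith
  · have : K.phi f q x = 1 := by simp [phi, hx, hg]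
    rw [this]; exact K.phi_le_one f q y

theorem phi_strict {f : K.Cell → ℝ}
    (hU : ∀ σ : K.Cell, {τ | K.Facet σ τ ∧ f τ < f σ}.Finite)
    {y x : K.Cell} (h : K.Below f y x) : ∃ q : ℚ, K.phi f q y < K.phi f q x := by
  rcases h with h | h
  · obtain ⟨q, h1, h2⟩ := exists_rat_btwn h.2
    refine ⟨q, ?_⟩
    have : K.phi f q y = 0 := by simp [phi, h1.le]
    rw [this]; exact K.phi_pos f q x h2
  · obtain ⟨t, ht, hg⟩ := K.exists_good hU _ x rfl
    obtain ⟨q, h1, h2⟩ := exists_rat_btwn ht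
    have hgx := Good.mono K hg h1.le
    have hgy := Good.facet K hgx h.1 h.2
    have hx : ¬ f x ≤ q := not_le.2 h2
    have hy : ¬ f y ≤ q := by rw [h.2]; exact hx
    have := K.frac_lt h.1
    refine ⟨q, ?_⟩
    simp only [phi, hy, hx, hgx, hgy, if_true, if_false]
    linarith

theorem exists_strict {f : K.Cell → ℝ}
    (hU : ∀ σ : K.Cell, {τ | K.Facet σ τ ∧ f τ < f σ}.Finite) :
    ∃ g : K.Cell → ℝ, ∀ y x, K.Below f y x → g y < g x := by
  let e := Denumerable.eqv ℚ
  have hs : ∀ x, Summable (fun n : ℕ => (1 / 2 : ℝ) ^ n * K.phi f (e.symm n : ℚ) x) := by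
    intro x
    refine Summable.of_nonneg_of_le (fun n => mul_nonneg (by positivity) (K.phi_nonneg _ _ _))
      (fun n => ?_) summable_geometric_two
    exact mul_le_of_le_one_right (by positivity) (K.phi_le_one _ _ _)
  refine ⟨fun x => ∑' n : ℕ, (1 / 2 : ℝ) ^ n * K.phi f (e.symm n : ℚ) x, fun y x h => ?_⟩
  obtain ⟨q, hq⟩ := K.phi_strict hU h
  refine Summable.tsum_lt_tsum (i := e q) (fun n => ?_) ?_ (hs y) (hs x)
  · exact mul_le_mul_of_nonneg_left (K.phi_mono _ h) (by positivity)
  · rw [Equiv.symm_apply_apply]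
    exact mul_lt_mul_of_pos_left hq (by positivity)

theorem RPath.right {f : K.Cell → ℝ} {r : ℝ} {σ τ : K.Cell} (h : K.RPath f r σ τ) :
    f τ = r := by
  rcases Relation.ReflTransGen.cases_tail h.2 with e | ⟨w, -, hw⟩
  · rw [e]; exact h.1
  · exact hw.2

theorem RPath.symm {f : K.Cell → ℝ} {r : ℝ} {σ τ : K.Cell} (h : K.RPath f r σ τ) :
    K.RPath f r τ σ := by
  obtain ⟨h0, h⟩ := h
  induction h with
  | refl => exact ⟨h0, .refl⟩
  | tail hab hbc ih =>
    exact ⟨hbc.2, Relation.ReflTransGen.head ⟨Or.symm hbc.1, ih.1⟩ ih.2⟩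

theorem exists_collection (f : K.Cell → ℝ) (σ : K.Cell) :
    ∃ C, K.IsCollection f C ∧ σ ∈ C ∧ ∀ τ ∈ C, f τ = f σ := by
  refine ⟨{τ | K.RPath f (f σ) σ τ}, ⟨⟨f σ, fun τ h => RPath.right K h, ?_⟩, ?_⟩,
    ⟨rfl, .refl⟩, fun τ h => RPath.right K h⟩
  · intro a ha b hb
    exact ⟨RPath.right K ha, (RPath.symm K ha).2.trans hb.2⟩
  · rintro C' hC ⟨c, hc, hp⟩
    refine Set.Subset.antisymm (fun τ hτ => ?_) hC
    have hσ : σ ∈ C' := hC ⟨rfl, .refl⟩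
    have := hp σ hσ τ hτ
    rw [← hc σ hσ] at this
    exact this

end CWComplexCells

/-- Lemma `lemsgvf`: for a discrete Morse–Bott function `f` whose
combinatorial vector field `−∇ₛf` is positively bounded, there is a discrete Morse
function `g` with `−∇ₛf = −∇g`. -/
theorem exists_discreteMorse_of_strict_negGradient {X : Type} [TopologicalSpace X]
    [T2Space X] (K : CWComplexCells X) (f : K.Cell → ℝ) (hf : K.DiscreteMorseBott f)
    (V : K.Cell → Option K.Cell)
    (hV : ∀ σ τ : K.Cell, V σ = some τ ↔ (K.Facet σ τ ∧ f σ > f τ))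
    (hPB : K.PositivelyBounded V) :
    ∃ g : K.Cell → ℝ, K.DiscreteMorse g ∧
      ∀ σ τ : K.Cell, V σ = some τ ↔ (K.Facet σ τ ∧ g σ ≥ g τ) := by
  have hU : ∀ σ : K.Cell, {τ | K.Facet σ τ ∧ f τ < f σ}.Finite := by
    intro σ
    apply Set.Subsingleton.finite
    intro a ha b hb
    have h1 := (hV σ a).2 ha
    rw [(hV σ b).2 hb] at h1
    exact (Option.some.inj h1).symm
  obtain ⟨g, hg⟩ := K.exists_strict hU
  have key : ∀ σ τ : K.Cell, K.Facet σ τ → (g σ ≥ g τ ↔ f σ > f τ) := by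
    intro σ τ h
    constructor
    · intro hge
      by_contra hn
      rcases (not_lt.1 hn).lt_or_eq with h1 | h1
      · exact absurd (hg σ τ (Or.inl ⟨Or.inl h, h1⟩)) hge.not_gt
      · exact absurd (hg σ τ (Or.inr ⟨h, h1⟩)) hge.not_gt
    · intro h1
      exact (hg τ σ (Or.inl ⟨Or.inr h, h1⟩)).le
  have hVg : ∀ σ τ : K.Cell, V σ = some τ ↔ (K.Facet σ τ ∧ g σ ≥ g τ) := by
    intro σ τ
    rw [hV]
    exact and_congr_right fun h => (key σ τ h).symm
  refine ⟨g, fun σ => ?_, hVg⟩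
  obtain ⟨C, hC, hσ, hCf⟩ := K.exists_collection f σ
  obtain ⟨m1, -, m3, m4⟩ := hf C hC σ hσ
  refine ⟨?_, ?_, ?_, ?_⟩
  · rintro τ ⟨hτ, hr⟩
    by_contra hn
    exact absurd (m1 τ ⟨hτ.1, hr⟩) ((key σ τ hτ).1 (not_lt.1 hn)).not_gt
  · unfold CWComplexCells.U
    rw [Set.encard_le_one_iff]
    intro a b ha hb
    have h1 := (hVg σ a).2 ha
    rw [(hVg σ b).2 hb] at h1
    exact (Option.some.inj h1).symm
  · rintro ν ⟨hν, hr⟩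
    by_contra hn
    exact absurd (m3 ν ⟨hν.1, hr⟩) ((key ν σ hν).1 (not_lt.1 hn)).not_gt
  · refine le_trans (Set.encard_le_encard ?_) m4
    rintro ν ⟨hν, hge⟩
    have h1 := (key ν σ hν).1 hge
    exact ⟨fun hm => h1.ne' (hCf ν hm), hν, h1.le⟩
end
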